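/- arXiv:1905.03374 — 2 statements merged into one kernel-verified Lean document; each statement's English description precedes it below -/
import Mathlib

section
/- Let k ≥ 2 be an integer and let E ⊆ ℕ be a generalised polynomial set such that kⁿ ∈ E for all integers n ≥ 0. Then the set {m ∈ ℕ : m·kⁿ ∈ E for infinitely many n ≥ 0} is IP*₊. -/
/-- Generalised polynomial maps `ℝ^d → ℝ`: the smallest family containing coordinate
maps and constants, closed under addition, multiplication and integer part. -/
inductive IsGenPoly {d : ℕ} : ((Fin d → ℝ) → ℝ) → Prop
  | coord (i : Fin d) : IsGenPoly (fun x => x i)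
  | const (c : ℝ) : IsGenPoly (fun _ => c)
  | add {f g : (Fin d → ℝ) → ℝ} : IsGenPoly f → IsGenPoly g →
      IsGenPoly (fun x => f x + g x)
  | mul {f g : (Fin d → ℝ) → ℝ} : IsGenPoly f → IsGenPoly g →
      IsGenPoly (fun x => f x * g x)
  | intPart {f : (Fin d → ℝ) → ℝ} : IsGenPoly f →
      IsGenPoly (fun x => (⌊f x⌋ : ℝ))

/-- A generalised polynomial on `ℕ`: the restriction to `ℕ` of a generalised
polynomial `ℝ → ℝ`. -/
def IsGenPolyNat (g : ℕ → ℝ) : Prop :=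
  ∃ f : (Fin 1 → ℝ) → ℝ, IsGenPoly f ∧ ∀ n : ℕ, g n = f (fun _ => (n : ℝ))

/-- A generalised polynomial subset of `ℕ`: the zero set of a generalised polynomial. -/
def IsGenPolySet (E : Set ℕ) : Prop :=
  ∃ g : ℕ → ℝ, IsGenPolyNat g ∧ E = {n : ℕ | g n = 0}
/-- Finite sums of a sequence over nonempty finite index sets. -/
def FS (a : ℕ → ℕ) : Set ℕ :=
  {m : ℕ | ∃ I : Finset ℕ, I.Nonempty ∧ m = ∑ i ∈ I, a i}

/-- A set is IP if it contains the finite sums of a sequence of positive integers. -/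
def IsIP (A : Set ℕ) : Prop :=
  ∃ a : ℕ → ℕ, (∀ i, 0 < a i) ∧ FS a ⊆ A

/-- A set is IP* if it meets every IP set. -/
def IsIPStar (E : Set ℕ) : Prop :=
  ∀ A : Set ℕ, IsIP A → (E ∩ A).Nonempty

/-- A set is IP*₊ if some (integer) translate of it is an IP* set. -/
def IsIPStarPlus (E : Set ℕ) : Prop :=
  ∃ t : ℤ, IsIPStar {n : ℕ | ∃ m ∈ E, (m : ℤ) = (n : ℤ) + t}

open Filter Topology

namespace GenPolyPowers

/-- Convergence modulo one of a real-valued function along a filter. -/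
def TendstoModOne (f : ℕ → ℝ) (l : Filter ℕ) (a : ℝ) : Prop :=
  ∀ ε > 0, ∀ᶠ n in l, ∃ z : ℤ, |f n - a - z| < ε

/-- Away from the integers, an integer part is locally constant modulo one. -/
theorem exists_pos_floor_eq {a : ℝ} (ha : ∀ z : ℤ, a ≠ z) :
    ∃ δ > 0, ∀ (x : ℝ) (z : ℤ), |x - a - z| < δ → ⌊x⌋ = ⌊a⌋ + z := by
  have h0 : 0 < Int.fract a := by
    rcases (Int.fract_nonneg a).lt_or_eq with h | h
    · exact h
    · exact absurd (by have := Int.floor_add_fract a; linarith) (ha ⌊a⌋)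
  have h1 := Int.fract_lt_one a
  have h2 := Int.floor_add_fract a
  refine ⟨min (Int.fract a) (1 - Int.fract a), lt_min h0 (by linarith), fun x z h => ?_⟩
  rw [lt_min_iff, abs_lt, abs_lt] at h
  rw [Int.floor_eq_iff]
  push_cast
  constructor <;> linarith [h.1.1, h.2.2]

theorem TendstoModOne.ne_int {f : ℕ → ℝ} {l : Filter ℕ} {a : ℝ} (h : TendstoModOne f l a)
    (ha : ∀ z : ℤ, a ≠ z) : ∀ᶠ n in l, ∀ z : ℤ, f n ≠ z := by
  obtain ⟨δ, hδ, H⟩ := exists_pos_floor_eq ha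
  filter_upwards [h (δ / 2) (by linarith)] with n ⟨w, hw⟩ z hz
  have h0 : |f n - a - w| < δ := by linarith
  have e0 := H _ _ h0
  have hpos : (0 : ℝ) < δ / 2 := by linarith
  rw [abs_lt] at hw
  have e1 := H (f n - δ / 2) w (by rw [abs_lt]; constructor <;> linarith [hw.1, hw.2])
  rw [hz, Int.floor_intCast] at e0
  rw [← e0, hz, Int.floor_eq_iff] at e1
  linarith [e1.1]

theorem TendstoModOne.tendsto_fract {f : ℕ → ℝ} {l : Filter ℕ} {a : ℝ} (h : TendstoModOne f l a)
    (ha : ∀ z : ℤ, a ≠ z) :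
    Tendsto (fun n => f n - ⌊f n⌋) l (𝓝 (a - ⌊a⌋)) := by
  obtain ⟨δ, hδ, H⟩ := exists_pos_floor_eq ha
  rw [Metric.tendsto_nhds]
  intro ε hε
  filter_upwards [h (min ε δ) (lt_min hε hδ)] with n ⟨w, hw⟩
  rw [lt_min_iff] at hw
  rw [H _ _ hw.2, Real.dist_eq]
  push_cast
  have : f n - (⌊a⌋ + w) - (a - ⌊a⌋) = f n - a - w := by ring
  rw [this]
  exact hw.1

theorem exists_tendsto_of_mem_Icc (q : Ultrafilter ℕ) {f : ℕ → ℝ} {a b : ℝ}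
    (h : ∀ᶠ n in q, f n ∈ Set.Icc a b) : ∃ x ∈ Set.Icc a b, Tendsto f q (𝓝 x) := by
  have := isCompact_Icc.ultrafilter_le_nhds (q.map f) (s := Set.Icc a b)
    (Filter.le_principal_iff.2 h)
  simpa [Tendsto] using this

theorem exists_tendstoModOne (q : Ultrafilter ℕ) (f : ℕ → ℝ) :
    ∃ a, TendstoModOne f q a := by
  obtain ⟨x, -, hx⟩ := exists_tendsto_of_mem_Icc q (f := fun n => Int.fract (f n)) (a := 0) (b := 1)
    (Eventually.of_forall fun n => ⟨Int.fract_nonneg _, (Int.fract_lt_one _).le⟩)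
  refine ⟨x, fun ε hε => ?_⟩
  filter_upwards [Metric.tendsto_nhds.1 hx ε hε] with n hn
  refine ⟨⌊f n⌋, ?_⟩
  rw [Real.dist_eq, Int.fract] at hn
  convert hn using 2
  ring

/-- Functions that are polynomial along a filter `r`, in the sense of iterated
differences, without constant term. -/
def IsIPPoly (r : Filter ℕ) : ℕ → (ℕ → ℝ) → Prop
  | 0, P => ∀ᶠ x in r, P x = 0
  | d + 1, P => ∀ᶠ x in r, IsIPPoly r d (fun y => P (x + y) - P x - P y)

/-- Half of idempotence of an ultrafilter for addition. -/
def AddIdem (r : Filter ℕ) : Prop :=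
  ∀ φ : ℕ → Prop, (∀ᶠ n in r, φ n) → ∀ᶠ m in r, ∀ᶠ n in r, φ (m + n)

section IPPoly

variable {r : Filter ℕ}

theorem IsIPPoly.congr (hr : AddIdem r) {d : ℕ} {P Q : ℕ → ℝ} (hP : IsIPPoly r d P)
    (h : ∀ᶠ x in r, P x = Q x) : IsIPPoly r d Q := by
  induction d generalizing P Q with
  | zero => filter_upwards [hP, h] with x h1 h2 using h2 ▸ h1
  | succ d ih =>
    filter_upwards [hP, h, hr _ h] with x h1 h2 h3
    refine ih h1 ?_
    filter_upwards [h, h3] with y h4 h5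
    rw [h2, h4, h5]

theorem IsIPPoly.zero (hr : AddIdem r) {d : ℕ} {P : ℕ → ℝ} (h : ∀ᶠ x in r, P x = 0) :
    IsIPPoly r d P := by
  induction d generalizing P with
  | zero => exact h
  | succ d ih =>
    filter_upwards [h, hr _ h] with x h2 h3
    refine ih ?_
    filter_upwards [h, h3] with y h4 h5
    rw [h2, h4, h5]; ring

theorem IsIPPoly.succ (hr : AddIdem r) {d : ℕ} {P : ℕ → ℝ} (h : IsIPPoly r d P) :
    IsIPPoly r (d + 1) P := by
  induction d generalizing P with
  | zero => exact IsIPPoly.zero hr h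
  | succ d ih => exact Eventually.mono (show ∀ᶠ x in r, _ from h) fun x hx => ih hx

theorem IsIPPoly.mono (hr : AddIdem r) {d e : ℕ} (hde : d ≤ e) {P : ℕ → ℝ}
    (h : IsIPPoly r d P) : IsIPPoly r e P := by
  induction hde with
  | refl => exact h
  | step _ ih => exact ih.succ hr

theorem IsIPPoly.add {d : ℕ} {P Q : ℕ → ℝ} (hP : IsIPPoly r d P) (hQ : IsIPPoly r d Q) :
    IsIPPoly r d (fun x => P x + Q x) := by
  induction d generalizing P Q with
  | zero => filter_upwards [hP, hQ] with x h1 h2; rw [h1, h2, add_zero]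
  | succ d ih =>
    filter_upwards [hP, hQ] with x h1 h2
    convert ih h1 h2 using 2
    ring

/-- Additive maps preserve polynomiality along `r`. -/
theorem IsIPPoly.map {d : ℕ} {P : ℕ → ℝ} (π : ℝ →+ ℝ) (hP : IsIPPoly r d P) :
    IsIPPoly r d (fun x => π (P x)) := by
  induction d generalizing P with
  | zero => filter_upwards [hP] with x h1; rw [h1, map_zero]
  | succ d ih =>
    filter_upwards [hP] with x h1
    simpa using ih h1

theorem IsIPPoly.const_mul {d : ℕ} {P : ℕ → ℝ} (c : ℝ) (hP : IsIPPoly r d P) :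
    IsIPPoly r d (fun x => c * P x) :=
  hP.map (AddMonoidHom.mulLeft c)

theorem IsIPPoly.mul (hr : AddIdem r) {a b : ℕ} {P Q : ℕ → ℝ}
    (hP : IsIPPoly r a P) (hQ : IsIPPoly r b Q) :
    IsIPPoly r (a + b) (fun x => P x * Q x) := by
  induction hn : a + b using Nat.strong_induction_on generalizing a b P Q with
  | _ n ih =>
  subst hn
  rcases a with _ | a
  · exact IsIPPoly.zero hr (by filter_upwards [hP] with x h; rw [h, zero_mul])
  rcases b with _ | b
  · exact IsIPPoly.zero hr (by filter_upwards [hQ] with x h; rw [h, mul_zero])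
  change ∀ᶠ x in r, IsIPPoly r (a + 1 + b) _
  filter_upwards [show ∀ᶠ x in r, _ from hP, show ∀ᶠ x in r, _ from hQ] with x h1 h2
  have t1 := (hQ.const_mul (P x)).mono hr (e := a + 1 + b) (by omega)
  have t2 := (hP.const_mul (Q x)).mono hr (e := a + 1 + b) (by omega)
  have t3 := (h2.const_mul (P x)).mono hr (e := a + 1 + b) (by omega)
  have t4 := (h1.const_mul (Q x)).mono hr (e := a + 1 + b) (by omega)
  have t5 := (ih _ (by omega) hP h2 rfl).mono hr (e := a + 1 + b) (by omega)
  have t6 := (ih _ (by omega) h1 hQ rfl).mono hr (e := a + 1 + b) (by omega)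
  have t7 := (ih _ (by omega) h1 h2 rfl).mono hr (e := a + 1 + b) (by omega)
  convert t1.add (t2.add (t3.add (t4.add (t5.add (t6.add t7))))) using 2
  ring

end IPPoly

section IPPolyUltra

variable {r : Ultrafilter ℕ}

theorem IsIPPoly.tendstoModOne (hr : AddIdem r) {d : ℕ} {P : ℕ → ℝ} (hP : IsIPPoly r d P) :
    TendstoModOne P r 0 := by
  induction d generalizing P with
  | zero =>
    intro ε hε
    filter_upwards [hP] with x h
    exact ⟨0, by simpa [h] using hε⟩
  | succ d ih =>
    obtain ⟨x, hx⟩ := exists_tendstoModOne r P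
    have key : ∀ ε > 0, ∃ z : ℤ, |x - z| < ε := by
      intro ε hε
      have hS := hx (ε / 4) (by linarith)
      have h1 : ∀ᶠ m in (r : Filter ℕ), IsIPPoly r d (fun y => P (m + y) - P m - P y) := hP
      obtain ⟨m, ⟨hm, hm'⟩, z1, hz1⟩ := ((h1.and (hr _ hS)).and hS).exists
      obtain ⟨n, ⟨⟨z12, hz12⟩, z2, hz2⟩, z3, hz3⟩ :=
        ((hm'.and hS).and (ih hm (ε / 4) (by linarith))).exists
      refine ⟨z12 - z1 - z2 - z3, ?_⟩
      rw [abs_lt] at *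
      push_cast
      constructor <;> linarith [hz1.1, hz1.2, hz12.1, hz12.2, hz2.1, hz2.2, hz3.1, hz3.2]
    intro ε hε
    obtain ⟨z, hz⟩ := key (ε / 2) (by linarith)
    filter_upwards [hx (ε / 2) (by linarith)] with n ⟨w, hw⟩
    refine ⟨w + z, ?_⟩
    rw [abs_lt] at *
    push_cast
    constructor <;> linarith [hz.1, hz.2, hw.1, hw.2]

theorem round_eq_of_abs_sub_lt {x : ℝ} {z : ℤ} (h : |x - z| < 1 / 2) : round x = z := by
  rw [round_eq, Int.floor_eq_iff]
  rw [abs_lt] at h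
  constructor <;> linarith [h.1, h.2]

theorem IsIPPoly.round (hr : AddIdem r) {d : ℕ} {P : ℕ → ℝ} (hP : IsIPPoly r d P) :
    IsIPPoly r d (fun x => (round (P x) : ℝ)) := by
  induction d generalizing P with
  | zero => filter_upwards [hP] with x h; simp [h]
  | succ d ih =>
    have hS := hP.tendstoModOne hr (1 / 8) (by norm_num)
    filter_upwards [show ∀ᶠ m in (r : Filter ℕ), _ from hP, hS] with m h1 ⟨z1, hz1⟩
    refine (ih h1).congr hr ?_
    filter_upwards [hS, h1.tendstoModOne hr (1 / 8) (by norm_num)] with n ⟨z2, hz2⟩ ⟨z3, hz3⟩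
    simp only [sub_zero] at *
    rw [round_eq_of_abs_sub_lt (hz1.trans (by norm_num)),
      round_eq_of_abs_sub_lt (hz2.trans (by norm_num)),
      round_eq_of_abs_sub_lt (hz3.trans (by norm_num)),
      round_eq_of_abs_sub_lt (x := P (m + n)) (z := z1 + z2 + z3)]
    · push_cast; ring
    · rw [abs_lt] at *
      push_cast
      constructor <;> linarith [hz1.1, hz1.2, hz2.1, hz2.2, hz3.1, hz3.2]

/-- If `F` is polynomial of degree at most `d + 1` along `r` and grows like `G` times a
positive power, then `G`, up to its limit, is polynomial of degree at most `d`. -/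
theorem IsIPPoly.leadingCoeff (hr : AddIdem r) (hr' : (r : Filter ℕ) ≤ atTop) {L : ℕ} (hL : L ≠ 0)
    {d : ℕ} {F G : ℕ → ℝ} {x : ℝ} (hF : IsIPPoly r (d + 1) F)
    (hlead : ∀ᶠ m in r, Tendsto (fun n : ℕ => F (m + n) / (n : ℝ) ^ L) r (𝓝 (G m)))
    (hcont : ∀ᶠ m in r, Tendsto (fun n => G (m + n)) r (𝓝 (G m)))
    (hx : Tendsto G r (𝓝 x)) : IsIPPoly r d (fun m => G m - x) := by
  have hinv : ∀ c : ℝ, Tendsto (fun n : ℕ => c / (n : ℝ) ^ L) r (𝓝 0) := fun c =>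
    Tendsto.const_div_atTop (((tendsto_pow_atTop hL).comp tendsto_natCast_atTop_atTop).mono_left hr') c
  induction d generalizing F G x with
  | zero =>
    have hF' : ∀ᶠ m in (r : Filter ℕ), ∀ᶠ n in (r : Filter ℕ), F (m + n) - F m - F n = 0 := hF
    have h2 : ∀ᶠ m in (r : Filter ℕ), Tendsto (fun n : ℕ => F n / (n : ℝ) ^ L) r (𝓝 (G m)) := by
      filter_upwards [hF', hlead] with m h1 h2
      have := h2.sub (hinv (F m))
      rw [sub_zero] at this
      refine this.congr' ?_
      filter_upwards [h1] with n hn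
      rw [← sub_div]
      congr 1; linarith
    obtain ⟨m₀, h0⟩ := h2.exists
    have h3 : ∀ᶠ m in (r : Filter ℕ), G m = G m₀ := by
      filter_upwards [h2] with m hm using tendsto_nhds_unique hm h0
    have h4 : x = G m₀ :=
      tendsto_nhds_unique hx (tendsto_const_nhds.congr' (h3.mono fun _ h => h.symm))
    change ∀ᶠ m in (r : Filter ℕ), _
    filter_upwards [h3] with m hm
    rw [hm, h4, sub_self]
  | succ d ih =>
    change ∀ᶠ m in (r : Filter ℕ), _
    filter_upwards [show ∀ᶠ m in (r : Filter ℕ), _ from hF, hr _ hlead, hr _ hcont, hcont]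
      with m h1 h2 h3 h4
    have := ih (G := fun n => G (m + n) - G n) (x := G m - x) h1 ?_ ?_ (h4.sub hx)
    · convert this using 2
      ring
    · filter_upwards [h2, hlead] with n h5 h6
      have := (h5.sub (hinv (F m))).sub h6
      rw [sub_zero] at this
      refine this.congr fun k => ?_
      rw [← sub_div, ← sub_div, add_assoc]
    · filter_upwards [h3, hcont] with n h5 h6
      simpa only [add_assoc] using h5.sub h6

end IPPolyUltra

section Ultra

/-- A multiplicatively idempotent ultrafilter `q` and a family `r` of additively idempotent
ultrafilters, all of them nonprincipal. -/
structure IsAdmissible (q : Ultrafilter ℕ) (r : ℕ → Ultrafilter ℕ) : Prop where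
  mul_idem : ∀ φ : ℕ → Prop, (∀ᶠ n in q, φ n) → ∀ᶠ m in q, ∀ᶠ n in q, φ (m * n)
  le_atTop : (q : Filter ℕ) ≤ atTop
  add_idem : ∀ t, AddIdem (r t)
  add_le_atTop : ∀ t, (r t : Filter ℕ) ≤ atTop

/-- The filter of properties that hold at `t + R` for `q`-most `t` and `r t`-most `R`. -/
def shift (q : Ultrafilter ℕ) (r : ℕ → Ultrafilter ℕ) : Filter ℕ :=
  (q : Filter ℕ).bind fun t => (r t : Filter ℕ).map (t + ·)

theorem eventually_shift {q : Ultrafilter ℕ} {r : ℕ → Ultrafilter ℕ} {φ : ℕ → Prop} :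
    (∀ᶠ m in shift q r, φ m) ↔ ∀ᶠ t in q, ∀ᶠ R in r t, φ (t + R) := by
  simp only [shift, eventually_bind, eventually_map]

/-- The algebra generated by the identity and by integer parts of functions that are
continuous along `q` modulo one and not integer valued. -/
inductive GoodFun (q : Ultrafilter ℕ) : (ℕ → ℝ) → Prop
  | const (c : ℝ) : GoodFun q (fun _ => c)
  | id : GoodFun q (fun m => (m : ℝ))
  | add {f g : ℕ → ℝ} : GoodFun q f → GoodFun q g → GoodFun q (fun m => f m + g m)
  | mul {f g : ℕ → ℝ} : GoodFun q f → GoodFun q g → GoodFun q (fun m => f m * g m)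
  | floor {p : ℕ → ℝ} : GoodFun q p →
      (∀ᶠ t in q, TendstoModOne (fun n => p (t * n)) q (p t)) →
      (∀ᶠ t in q, ∀ z : ℤ, p t ≠ z) → GoodFun q (fun m => (⌊p m⌋ : ℝ))

variable {q : Ultrafilter ℕ} {r : ℕ → Ultrafilter ℕ}

theorem GoodFun.const_mul {f : ℕ → ℝ} (c : ℝ) (hf : GoodFun q f) :
    GoodFun q (fun m => c * f m) :=
  (GoodFun.const c).mul hf

theorem GoodFun.sub {f g : ℕ → ℝ} (hf : GoodFun q f) (hg : GoodFun q g) :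
    GoodFun q (fun m => f m - g m) := by
  convert hf.add (hg.const_mul (-1)) using 2
  ring

theorem GoodFun.sum {ι : Type*} (s : Finset ι) {f : ι → ℕ → ℝ} (hf : ∀ i, GoodFun q (f i)) :
    GoodFun q (fun m => ∑ i ∈ s, f i m) := by
  classical
  induction s using Finset.induction_on with
  | empty => simpa using GoodFun.const (q := q) 0
  | insert a s ha ih => simpa only [Finset.sum_insert ha] using (hf a).add ih

theorem isIPPoly_floor_sub {u : Ultrafilter ℕ} (hu : AddIdem u) {D : ℕ} {p : ℕ → ℝ} {a : ℝ}
    (hp : IsIPPoly u D (fun R => p R - a)) (ha : ∀ z : ℤ, a ≠ z) :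
    IsIPPoly u D (fun R => (⌊p R⌋ : ℝ) - ⌊a⌋) := by
  refine (hp.round hu).congr hu ?_
  obtain ⟨δ, hδ, H⟩ := exists_pos_floor_eq ha
  filter_upwards [hp.tendstoModOne hu (min δ (1 / 2)) (lt_min hδ (by norm_num))] with R ⟨z, hz⟩
  rw [sub_zero, lt_min_iff] at hz
  rw [round_eq_of_abs_sub_lt hz.2, H _ _ hz.1]
  push_cast
  ring

theorem GoodFun.isIPPoly (h : IsAdmissible q r) {f : ℕ → ℝ} (hf : GoodFun q f) :
    ∃ D, ∀ᶠ t in q, IsIPPoly (r t) D (fun R => f (t + R) - f t) := by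
  induction hf with
  | const c =>
    exact ⟨0, Eventually.of_forall fun t => Eventually.of_forall fun R => sub_self c⟩
  | id =>
    refine ⟨1, Eventually.of_forall fun t => Eventually.of_forall fun R =>
      Eventually.of_forall fun R' => ?_⟩
    push_cast
    ring
  | @add f g _ _ ihf ihg =>
    obtain ⟨a, ha⟩ := ihf
    obtain ⟨b, hb⟩ := ihg
    refine ⟨a + b, ?_⟩
    filter_upwards [ha, hb] with t h1 h2
    convert (h1.mono (h.add_idem t) (Nat.le_add_right a b)).add
      (h2.mono (h.add_idem t) (Nat.le_add_left b a)) using 2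
    ring
  | @mul f g _ _ ihf ihg =>
    obtain ⟨a, ha⟩ := ihf
    obtain ⟨b, hb⟩ := ihg
    refine ⟨a + b, ?_⟩
    filter_upwards [ha, hb] with t h1 h2
    convert ((h1.const_mul (g t)).mono (h.add_idem t) (Nat.le_add_right a b)).add
      (((h2.const_mul (f t)).mono (h.add_idem t) (Nat.le_add_left b a)).add
      (h1.mul (h.add_idem t) h2)) using 2
    ring
  | @floor p _ _ hne ih =>
    obtain ⟨a, ha⟩ := ih
    refine ⟨a, ?_⟩
    filter_upwards [ha, hne] with t h1 h2
    exact isIPPoly_floor_sub (p := fun R => p (t + R)) (h.add_idem t) h1 h2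

theorem GoodFun.tendstoModOne (h : IsAdmissible q r) {f : ℕ → ℝ} (hf : GoodFun q f) :
    ∀ᶠ t in q, TendstoModOne (fun R => f (t + R)) (r t) (f t) := by
  obtain ⟨D, hD⟩ := hf.isIPPoly h
  filter_upwards [hD] with t ht
  simpa [TendstoModOne] using ht.tendstoModOne (h.add_idem t)

theorem GoodFun.tendstoModOne_add_add (h : IsAdmissible q r) {f : ℕ → ℝ} (hf : GoodFun q f) :
    ∀ᶠ t in q, ∀ᶠ m in r t, TendstoModOne (fun n => f (t + (m + n))) (r t) (f (t + m)) := by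
  obtain ⟨D, hD⟩ := hf.isIPPoly h
  filter_upwards [hD] with t ht
  have h1 : ∀ᶠ m in r t, IsIPPoly (r t) D (fun n => f (t + (m + n)) - f t - (f (t + m) - f t)
      - (f (t + n) - f t)) := ht.succ (h.add_idem t)
  filter_upwards [h1] with m hm
  have h2 := (hm.add ht).tendstoModOne (h.add_idem t)
  intro ε hε
  filter_upwards [h2 ε hε] with n ⟨z, hz⟩
  refine ⟨z, ?_⟩
  convert hz using 2
  ring

/-- Elements of the algebra of good functions that are continuous along `q` and along
every `r t`. -/
structure IsLimFun (q : Ultrafilter ℕ) (r : ℕ → Ultrafilter ℕ) (G : ℕ → ℝ) : Prop where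
  good : GoodFun q G
  mul : ∀ᶠ t in q, Tendsto (fun n => G (t * n)) q (𝓝 (G t))
  add : ∀ᶠ t in q, Tendsto (fun R => G (t + R)) (r t) (𝓝 (G t))
  add_add : ∀ᶠ t in q, ∀ᶠ m in r t, Tendsto (fun n => G (t + (m + n))) (r t) (𝓝 (G (t + m)))

/-- The algebra of functions continuous along `q` and along every `r t`. -/
def limAlg (q : Ultrafilter ℕ) (r : ℕ → Ultrafilter ℕ) : Subalgebra ℝ (ℕ → ℝ) where
  carrier := {G | IsLimFun q r G}
  mul_mem' {f g} hf hg :=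
    { good := hf.good.mul hg.good
      mul := by filter_upwards [hf.mul, hg.mul] with t h1 h2 using h1.mul h2
      add := by filter_upwards [hf.add, hg.add] with t h1 h2 using h1.mul h2
      add_add := by
        filter_upwards [hf.add_add, hg.add_add] with t h1 h2
        filter_upwards [h1, h2] with m h1 h2 using h1.mul h2 }
  add_mem' {f g} hf hg :=
    { good := hf.good.add hg.good
      mul := by filter_upwards [hf.mul, hg.mul] with t h1 h2 using h1.add h2
      add := by filter_upwards [hf.add, hg.add] with t h1 h2 using h1.add h2
      add_add := by
        filter_upwards [hf.add_add, hg.add_add] with t h1 h2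
        filter_upwards [h1, h2] with m h1 h2 using h1.add h2 }
  algebraMap_mem' c :=
    { good := GoodFun.const c
      mul := Eventually.of_forall fun _ => tendsto_const_nhds
      add := Eventually.of_forall fun _ => tendsto_const_nhds
      add_add := Eventually.of_forall fun _ => Eventually.of_forall fun _ => tendsto_const_nhds }

theorem isLimFun_sub_floor (h : IsAdmissible q r) {p : ℕ → ℝ} (hp : GoodFun q p)
    (hlim : ∀ᶠ t in q, TendstoModOne (fun n => p (t * n)) q (p t))
    (hne : ∀ᶠ t in q, ∀ z : ℤ, p t ≠ z) : IsLimFun q r (fun m => p m - ⌊p m⌋) where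
  good := hp.sub (hp.floor hlim hne)
  mul := by filter_upwards [hlim, hne] with t h1 h2 using h1.tendsto_fract h2
  add := by filter_upwards [hp.tendstoModOne h, hne] with t h1 h2 using h1.tendsto_fract h2
  add_add := by
    filter_upwards [hp.tendstoModOne h, hne, hp.tendstoModOne_add_add h] with t h1 h2 h3
    filter_upwards [h1.ne_int h2, h3] with m h4 h5 using h5.tendsto_fract h4

theorem GoodFun.mem_range_aeval (h : IsAdmissible q r) {f : ℕ → ℝ} (hf : GoodFun q f) :
    f ∈ (Polynomial.aeval (R := limAlg q r) (fun m : ℕ => (m : ℝ))).range := by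
  induction hf with
  | const c => exact ⟨Polynomial.C (algebraMap ℝ (limAlg q r) c), by ext; simp⟩
  | id => exact ⟨Polynomial.X, by simp⟩
  | add _ _ ihf ihg => exact add_mem ihf ihg
  | mul _ _ ihf ihg => exact mul_mem ihf ihg
  | @floor p hp hlim hne ih =>
    have h1 : (fun m => p m - ⌊p m⌋) ∈
        (Polynomial.aeval (R := limAlg q r) (fun m : ℕ => (m : ℝ))).range :=
      ⟨Polynomial.C ⟨_, isLimFun_sub_floor h hp hlim hne⟩, by simp⟩
    convert sub_mem ih h1 using 1
    ext m
    simp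

theorem GoodFun.exists_eq_sum (h : IsAdmissible q r) {f : ℕ → ℝ} (hf : GoodFun q f) :
    ∃ (L : ℕ) (G : ℕ → ℕ → ℝ), (∀ i, IsLimFun q r (G i)) ∧
      ∀ m, f m = ∑ i ∈ Finset.range (L + 1), (m : ℝ) ^ i * G i m := by
  obtain ⟨P, rfl⟩ := hf.mem_range_aeval h
  refine ⟨P.natDegree, fun i => P.coeff i, fun i => (P.coeff i).2, fun m => ?_⟩
  simp only [RingHom.coe_coe, AlgHom.toRingHom_eq_coe, Polynomial.aeval_eq_sum_range, Finset.sum_apply]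
  refine Finset.sum_congr rfl fun i _ => ?_
  rw [mul_comm]
  rfl

theorem tendsto_sum_div_pow {l : Filter ℕ} (hl : l ≤ atTop) {φ : ℕ → ℕ} {c : ℝ}
    (hφ : Tendsto (fun n => (φ n : ℝ) / n) l (𝓝 c)) {L : ℕ} {G : ℕ → ℕ → ℝ} {g : ℕ → ℝ}
    (hG : ∀ i ∈ Set.Iic L, Tendsto (fun n => G i (φ n)) l (𝓝 (g i))) :
    Tendsto (fun n => (∑ i ∈ Finset.range (L + 1), (φ n : ℝ) ^ i * G i (φ n)) / (n : ℝ) ^ L) l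
      (𝓝 (c ^ L * g L)) := by
  have h1 : ∀ i ∈ Finset.range (L + 1), Tendsto
      (fun n : ℕ => ((φ n : ℝ) / n) ^ i * G i (φ n) * (1 / (n : ℝ) ^ (L - i))) l
      (𝓝 (if i = L then c ^ L * g L else 0)) := by
    intro i hi
    have hi' := Finset.mem_range.1 hi
    have hGi := hG i (Set.mem_Iic.2 (by omega))
    split_ifs with hiL
    · subst hiL
      simpa using (hφ.pow i).mul hGi
    · have h2 : Tendsto (fun n : ℕ => 1 / (n : ℝ) ^ (L - i)) l (𝓝 0) :=
        Tendsto.const_div_atTop (((tendsto_pow_atTop (by omega)).comp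
          tendsto_natCast_atTop_atTop).mono_left hl) 1
      simpa using ((hφ.pow i).mul hGi).mul h2
  have h3 := tendsto_finsetSum _ h1
  rw [Finset.sum_ite_eq' (Finset.range (L + 1)) L, if_pos (by simp)] at h3
  refine h3.congr' ?_
  filter_upwards [hl (eventually_gt_atTop 0)] with n hn
  rw [Finset.sum_div]
  refine Finset.sum_congr rfl fun i hi => ?_
  have hi' := Finset.mem_range.1 hi
  have hn' : (n : ℝ) ≠ 0 := by positivity
  have : (n : ℝ) ^ L = n ^ i * n ^ (L - i) := by rw [← pow_add]; congr 1; omega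
  rw [this, div_pow]
  field_simp

theorem tendsto_mul_natCast_div {l : Filter ℕ} (hl : l ≤ atTop) (t : ℕ) :
    Tendsto (fun n : ℕ => ((t * n : ℕ) : ℝ) / n) l (𝓝 t) := by
  refine tendsto_const_nhds.congr' ?_
  filter_upwards [hl (eventually_gt_atTop 0)] with n hn
  have hn' : (n : ℝ) ≠ 0 := by positivity
  push_cast
  field_simp

theorem tendsto_add_natCast_div {l : Filter ℕ} (hl : l ≤ atTop) (t : ℕ) :
    Tendsto (fun n : ℕ => ((t + n : ℕ) : ℝ) / n) l (𝓝 1) := by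
  have h1 : Tendsto (fun n : ℕ => (t : ℝ) / n) l (𝓝 0) :=
    Tendsto.const_div_atTop (tendsto_natCast_atTop_atTop.mono_left hl) _
  have h2 := h1.add_const (1 : ℝ)
  rw [zero_add] at h2
  refine h2.congr' ?_
  filter_upwards [hl (eventually_gt_atTop 0)] with n hn
  have hn' : (n : ℝ) ≠ 0 := by positivity
  push_cast
  field_simp

section Leading

variable {f : ℕ → ℝ} {L : ℕ} {G : ℕ → ℕ → ℝ}

/-- `f` has the expansion `∑ m ^ i * G i m` along the filter `l`. -/
def HasExpansion (l : Filter ℕ) (f : ℕ → ℝ) (L : ℕ) (G : ℕ → ℕ → ℝ) : Prop :=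
  ∀ᶠ m in l, f m = ∑ i ∈ Finset.range (L + 1), (m : ℝ) ^ i * G i m

theorem HasExpansion.of_succ {l : Filter ℕ} (hf : HasExpansion l f (L + 1) G)
    (h0 : ∀ᶠ m in l, G (L + 1) m = 0) : HasExpansion l f L G := by
  filter_upwards [hf, h0] with m h1 h2
  rw [h1, Finset.sum_range_succ, h2, mul_zero, add_zero]

theorem HasExpansion.tendsto_mul (h : IsAdmissible q r) (hG : ∀ i, IsLimFun q r (G i))
    (hf : HasExpansion q f L G) :
    ∀ᶠ t in q, Tendsto (fun n : ℕ => f (t * n) / (n : ℝ) ^ L) q (𝓝 ((t : ℝ) ^ L * G L t)) := by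
  filter_upwards [h.mul_idem _ hf, (eventually_all_finite (Set.finite_Iic L)).2
    fun i _ => (hG i).mul] with t h1 h2
  refine (tendsto_sum_div_pow h.le_atTop (tendsto_mul_natCast_div h.le_atTop t) h2).congr' ?_
  filter_upwards [h1] with n hn
  rw [hn]

theorem HasExpansion.tendsto_add (h : IsAdmissible q r) (hG : ∀ i, IsLimFun q r (G i))
    (hf : HasExpansion (shift q r) f L G) :
    ∀ᶠ t in q, Tendsto (fun n : ℕ => f (t + n) / (n : ℝ) ^ L) (r t) (𝓝 (G L t)) := by
  filter_upwards [eventually_shift.1 hf, (eventually_all_finite (Set.finite_Iic L)).2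
    fun i _ => (hG i).add] with t h1 h2
  have := tendsto_sum_div_pow (h.add_le_atTop t) (tendsto_add_natCast_div (h.add_le_atTop t) t) h2
  rw [one_pow, one_mul] at this
  refine this.congr' ?_
  filter_upwards [h1] with n hn
  rw [hn]

theorem HasExpansion.tendsto_add_add (h : IsAdmissible q r) (hG : ∀ i, IsLimFun q r (G i))
    (hf : HasExpansion (shift q r) f L G) :
    ∀ᶠ t in q, ∀ᶠ m in r t,
      Tendsto (fun n : ℕ => f (t + (m + n)) / (n : ℝ) ^ L) (r t) (𝓝 (G L (t + m))) := by
  filter_upwards [eventually_shift.1 hf, (eventually_all_finite (Set.finite_Iic L)).2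
    fun i _ => (hG i).add_add] with t h1 h2
  filter_upwards [h.add_idem t _ h1, (eventually_all_finite (Set.finite_Iic L)).2 h2] with m h3 h4
  have h5 := tendsto_add_natCast_div (h.add_le_atTop t) (t + m)
  simp only [add_assoc] at h5
  have := tendsto_sum_div_pow (h.add_le_atTop t) h5 h4
  rw [one_pow, one_mul] at this
  refine this.congr' ?_
  filter_upwards [h3] with n hn
  rw [hn]

end Leading

theorem HasExpansion.leading_eq_zero (h : IsAdmissible q r) {f : ℕ → ℝ} {L : ℕ} {G : ℕ → ℕ → ℝ}
    (hG : ∀ i, IsLimFun q r (G i)) (hf : HasExpansion q f L G) (h0 : ∀ᶠ m in q, f m = 0) :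
    ∀ᶠ m in q, G L m = 0 := by
  filter_upwards [hf.tendsto_mul h hG, h.mul_idem _ h0, h.le_atTop (eventually_gt_atTop 0)]
    with t h1 h2 ht
  have h3 : Tendsto (fun n : ℕ => f (t * n) / (n : ℝ) ^ L) q (𝓝 0) := by
    refine tendsto_const_nhds.congr' ?_
    filter_upwards [h2] with n hn
    rw [hn, zero_div]
  have h4 := tendsto_nhds_unique h1 h3
  have ht' : (t : ℝ) ^ L ≠ 0 := by positivity
  exact (mul_eq_zero.1 h4).resolve_left ht'

/-- A good function is, as far as vanishing is concerned, a finite family of integer valued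
good functions. -/
theorem GoodFun.exists_int_coords {f : ℕ → ℝ} (hf : GoodFun q f) :
    ∃ (ι : Type) (s : Finset ι) (π : ι → ℝ →+ ℝ),
      (∀ j ∈ s, GoodFun q (fun m => π j (f m)) ∧ ∀ m, ∃ z : ℤ, π j (f m) = z) ∧
      ∀ m, (∀ j ∈ s, π j (f m) = 0) → f m = 0 := by
  let W : Submonoid (ℕ → ℝ) :=
    { carrier := {g | GoodFun q g ∧ ∀ m, ∃ z : ℤ, g m = z}
      mul_mem' := fun {f g} hf hg => ⟨hf.1.mul hg.1, fun m => by
        obtain ⟨a, ha⟩ := hf.2 m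
        obtain ⟨b, hb⟩ := hg.2 m
        exact ⟨a * b, by simp [ha, hb]⟩⟩
      one_mem' := ⟨GoodFun.const 1, fun m => ⟨1, by simp⟩⟩ }
  have hmem : f ∈ Algebra.adjoin ℝ (W : Set (ℕ → ℝ)) := by
    induction hf with
    | const c => exact Subalgebra.algebraMap_mem _ c
    | id => exact Algebra.subset_adjoin ⟨GoodFun.id, fun m => ⟨m, by simp⟩⟩
    | add _ _ h1 h2 => exact add_mem h1 h2
    | mul _ _ h1 h2 => exact mul_mem h1 h2
    | floor h1 h2 h3 => exact Algebra.subset_adjoin ⟨h1.floor h2 h3, fun m => ⟨_, rfl⟩⟩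
  rw [← Subalgebra.mem_toSubmodule, Algebra.adjoin_eq_span, Submonoid.closure_eq,
    Submodule.mem_span_set'] at hmem
  obtain ⟨n, a, g, rfl⟩ := hmem
  let B := Module.Basis.ofVectorSpace ℚ ℝ
  classical
  let N : Module.Basis.ofVectorSpaceIndex ℚ ℝ → ℕ := fun b => ∏ i, (B.repr (a i) b).den
  have hN : ∀ b, N b ≠ 0 := fun b => Finset.prod_ne_zero_iff.2 fun i _ => Rat.den_nz _
  let π : Module.Basis.ofVectorSpaceIndex ℚ ℝ → ℝ →+ ℝ := fun b =>
    (AddMonoidHom.mulLeft (N b : ℝ)).comp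
      ((Rat.castHom ℝ).toAddMonoidHom.comp (B.coord b).toAddMonoidHom)
  have hπ : ∀ b x, π b x = N b * (B.repr x b : ℝ) := fun b x => rfl
  have hπint : ∀ b x (z : ℤ), π b (x * z) = π b x * z := fun b x z => by
    rw [mul_comm, ← zsmul_eq_mul, map_zsmul, zsmul_eq_mul, mul_comm]
  have hval : ∀ b m, π b ((∑ i, a i • (g i : ℕ → ℝ)) m) = ∑ i, π b (a i) * (g i : ℕ → ℝ) m := by
    intro b m
    rw [Finset.sum_apply, map_sum]
    refine Finset.sum_congr rfl fun i _ => ?_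
    obtain ⟨z, hz⟩ := (g i).2.2 m
    rw [Pi.smul_apply, smul_eq_mul, hz, hπint]
  have hint : ∀ b i, ∃ z : ℤ, π b (a i) = z := by
    intro b i
    obtain ⟨w, hw⟩ : (B.repr (a i) b).den ∣ N b := Finset.dvd_prod_of_mem _ (Finset.mem_univ i)
    refine ⟨w * (B.repr (a i) b).num, ?_⟩
    rw [hπ, hw]
    push_cast
    have hq : ((B.repr (a i) b).den : ℝ) * ((B.repr (a i) b : ℚ) : ℝ) = (B.repr (a i) b).num := by
      exact_mod_cast Rat.den_mul_eq_num _
    rw [← hq]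
    ring
  refine ⟨_, Finset.univ.biUnion fun i => (B.repr (a i)).support, π, fun b _ => ⟨?_, fun m => ?_⟩,
    fun m h0 => ?_⟩
  · simp only [hval]
    exact GoodFun.sum _ fun i => (g i).2.1.const_mul _
  · rw [hval]
    choose z hz using fun i => (g i).2.2 m
    choose w hw using hint b
    exact ⟨∑ i, w i * z i, by push_cast; simp only [hz, hw]⟩
  · refine (B.repr.map_eq_zero_iff).1 (Finsupp.ext fun b => ?_)
    have h1 : π b ((∑ i, a i • (g i : ℕ → ℝ)) m) = 0 := by
      by_cases hb : b ∈ Finset.univ.biUnion fun i => (B.repr (a i)).support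
      · exact h0 b hb
      · rw [hval]
        refine Finset.sum_eq_zero fun i _ => ?_
        have : B.repr (a i) b = 0 := by
          by_contra hne
          exact hb (Finset.mem_biUnion.2 ⟨i, Finset.mem_univ i, Finsupp.mem_support_iff.2 hne⟩)
        rw [hπ, this, Rat.cast_zero, mul_zero, zero_mul]
    rw [hπ] at h1
    have := (mul_eq_zero.1 h1).resolve_left (Nat.cast_ne_zero.2 (hN b))
    exact_mod_cast this

theorem GoodFun.eventually_shift_eq_zero_of_isIPPoly (h : IsAdmissible q r) {D : ℕ} {f : ℕ → ℝ}
    (hf : GoodFun q f) (hD : ∀ᶠ t in q, IsIPPoly (r t) D (fun R => f (t + R)))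
    (h0 : ∀ᶠ m in q, f m = 0) : ∀ᶠ m in shift q r, f m = 0 := by
  induction D generalizing f with
  | zero => exact eventually_shift.2 hD
  | succ D ih =>
    obtain ⟨ι, s, π, hπ, hker⟩ := hf.exists_int_coords
    suffices H : ∀ j ∈ s, ∀ᶠ m in shift q r, π j (f m) = 0 by
      filter_upwards [(eventually_all_finset s).2 H] with m hm using hker m hm
    intro j hj
    obtain ⟨hg, hint⟩ := hπ j hj
    have hgD : ∀ᶠ t in q, IsIPPoly (r t) (D + 1) (fun R => π j (f (t + R))) := by
      filter_upwards [hD] with t ht using ht.map (π j)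
    have hg0 : ∀ᶠ m in q, π j (f m) = 0 := by
      filter_upwards [h0] with m hm
      rw [hm, map_zero]
    generalize hgdef : (fun m => π j (f m)) = g at hg
    simp only [funext_iff] at hgdef
    simp only [hgdef] at hint hgD hg0 ⊢
    obtain ⟨L, G, hG, hexp⟩ := hg.exists_eq_sum h
    have e1 : HasExpansion q g L G := Eventually.of_forall hexp
    have e2 : HasExpansion (shift q r) g L G := Eventually.of_forall hexp
    clear hexp
    induction L with
    | zero =>
      rw [eventually_shift]
      filter_upwards [e2.tendsto_add h hG, e1.leading_eq_zero h hG hg0] with t h1 h2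
      rw [h2] at h1
      filter_upwards [Metric.tendsto_nhds.1 h1 1 one_pos] with R hR
      obtain ⟨z, hz⟩ := hint (t + R)
      rw [pow_zero, div_one, Real.dist_eq, sub_zero, hz] at hR
      have : |z| < 1 := by exact_mod_cast hR
      rw [hz, Int.abs_lt_one_iff.1 this, Int.cast_zero]
    | succ L ihL =>
      have hlead := e1.leading_eq_zero h hG hg0
      have hs : ∀ᶠ m in shift q r, G (L + 1) m = 0 := by
        refine ih (hG _).good ?_ hlead
        filter_upwards [hgD, e2.tendsto_add_add h hG, (hG (L + 1)).add, (hG (L + 1)).add_add,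
          hlead] with t h1 h2 h3 h4 h5
        rw [h5] at h3
        simpa using IsIPPoly.leadingCoeff (h.add_idem t) (h.add_le_atTop t) (Nat.succ_ne_zero L)
          h1 h2 h4 h3
      exact ihL (e1.of_succ hlead) (e2.of_succ hs)

/-- A good function vanishing along `q` vanishes along `shift q r`. -/
theorem GoodFun.eventually_shift_eq_zero (h : IsAdmissible q r) {f : ℕ → ℝ}
    (hf : GoodFun q f) (h0 : ∀ᶠ m in q, f m = 0) : ∀ᶠ m in shift q r, f m = 0 := by
  obtain ⟨D, hD⟩ := hf.isIPPoly h
  refine hf.eventually_shift_eq_zero_of_isIPPoly h (D := D) ?_ h0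
  filter_upwards [hD, h0] with t h1 h2
  simpa [h2] using h1

theorem exists_eventually_eq {α : Type*} [Finite α] (u : Ultrafilter ℕ) (f : ℕ → α) :
    ∃ a, ∀ᶠ m in u, f m = a := by
  obtain ⟨a, ha⟩ := Ultrafilter.eq_pure_of_finite (u.map f)
  refine ⟨a, ?_⟩
  have : {a} ∈ u.map f := by rw [ha]; exact Set.mem_singleton a
  exact this

theorem eventually_sign_eq {l : Filter ℕ} {x : ℕ → ℝ} {a : ℝ} (ha : a ≠ 0)
    (hx : Tendsto x l (𝓝 a)) : ∀ᶠ n in l, SignType.sign (x n) = SignType.sign a := by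
  rcases ha.lt_or_gt with h | h
  · filter_upwards [hx.eventually_lt_const h] with n hn
    rw [sign_neg hn, sign_neg h]
  · filter_upwards [hx.eventually_const_lt h] with n hn
    rw [sign_pos hn, sign_pos h]

/-- The sign of a good function is the same constant along `q` and along `shift q r`. -/
theorem GoodFun.exists_sign_eq (h : IsAdmissible q r) {f : ℕ → ℝ} (hf : GoodFun q f) :
    ∃ σ, ∀ᶠ m in (q : Filter ℕ) ⊔ shift q r, SignType.sign (f m) = σ := by
  simp only [eventually_sup]
  obtain ⟨σ, hσ⟩ := exists_eventually_eq q (fun m => SignType.sign (f m))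
  refine ⟨σ, hσ, ?_⟩
  obtain ⟨L, G, hG, hexp⟩ := hf.exists_eq_sum h
  have e1 : HasExpansion q f L G := Eventually.of_forall hexp
  have e2 : HasExpansion (shift q r) f L G := Eventually.of_forall hexp
  clear hexp
  have hdrop : (∀ᶠ m in q, f m = 0) → ∀ᶠ m in shift q r, SignType.sign (f m) = σ := by
    intro h0
    obtain ⟨m, h1, h2⟩ := (hσ.and h0).exists
    filter_upwards [hf.eventually_shift_eq_zero h h0] with m' hm'
    rw [← h1, h2, hm']
  have hmain : ∀ L, HasExpansion q f L G → HasExpansion (shift q r) f L G →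
      (∀ᶠ m in q, G L m ≠ 0) → ∀ᶠ m in shift q r, SignType.sign (f m) = σ := by
    intro L e1 e2 hne
    rw [eventually_shift]
    filter_upwards [e1.tendsto_mul h hG, e2.tendsto_add h hG, hne, h.mul_idem _ hσ,
      h.le_atTop (eventually_gt_atTop 0)] with t h1 h2 h3 h4 ht
    have ht' : (0 : ℝ) < (t : ℝ) ^ L := by positivity
    have hsign : ∀ (n : ℕ) (x : ℝ), 0 < n →
        SignType.sign (x / (n : ℝ) ^ L) = SignType.sign x := by
      intro n x hn
      have : (0 : ℝ) < ((n : ℝ) ^ L)⁻¹ := by positivity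
      rw [div_eq_mul_inv, sign_mul, sign_pos this, mul_one]
    obtain ⟨n, hn, h5, hn0⟩ := ((eventually_sign_eq (mul_ne_zero ht'.ne' h3) h1).and
      (h4.and (h.le_atTop (eventually_gt_atTop 0)))).exists
    rw [hsign _ _ hn0, h5, sign_mul, sign_pos ht', one_mul] at hn
    filter_upwards [eventually_sign_eq h3 h2, h.add_le_atTop t (eventually_gt_atTop 0)] with R hR hR0
    rw [← hsign R _ hR0, hR, hn]
  induction L with
  | zero =>
    rcases q.em (fun m => G 0 m = 0) with h0 | h0
    · refine hdrop ?_
      filter_upwards [e1, h0] with m h1 h2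
      rw [h1]
      simp [h2]
    · exact hmain 0 e1 e2 h0
  | succ L ih =>
    rcases q.em (fun m => G (L + 1) m = 0) with h0 | h0
    · exact ih (e1.of_succ h0) (e2.of_succ ((hG _).good.eventually_shift_eq_zero h h0))
    · exact hmain _ e1 e2 h0

/-- A finite bilinear form in good functions of `m` and arbitrary functions of `n` has an
eventually constant sign. -/
theorem exists_sign_sum_eq (h : IsAdmissible q r) {ι : Type*} (s : Finset ι) (ε : ι → ℕ → ℝ)
    {f : ι → ℕ → ℝ} (hf : ∀ i, GoodFun q (f i)) :
    ∃ σ, ∀ᶠ m in (q : Filter ℕ) ⊔ shift q r, ∀ᶠ n in q,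
      SignType.sign (∑ i ∈ s, ε i n * f i m) = σ := by
  classical
  induction hs : s.card generalizing s ε with
  | zero =>
    rw [Finset.card_eq_zero] at hs
    subst hs
    exact ⟨0, by simp⟩
  | succ N ih =>
    have hne : s.Nonempty := Finset.card_pos.1 (by omega)
    choose k hk hmax using fun n => s.exists_max_image (fun i => |ε i n|) hne
    obtain ⟨⟨j, hj⟩, hjk⟩ := exists_eventually_eq q (fun n => (⟨k n, hk n⟩ : s))
    have hjmax : ∀ᶠ n in q, ∀ i ∈ s, |ε i n| ≤ |ε j n| := by
      filter_upwards [hjk] with n hn i hi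
      have := hmax n i hi
      rwa [show k n = j from congrArg Subtype.val hn] at this
    rcases q.em (fun n => ε j n = 0) with h0 | h0
    · refine ⟨0, Eventually.of_forall fun m => ?_⟩
      filter_upwards [hjmax, h0] with n h1 h2
      rw [Finset.sum_eq_zero, sign_zero]
      intro i hi
      have := h1 i hi
      rw [h2, abs_zero] at this
      rw [abs_nonpos_iff.1 this, zero_mul]
    have hlim : ∀ i, ∃ ℓ, i ∈ s → Tendsto (fun n => ε i n / ε j n) q (𝓝 ℓ) := by
      intro i
      by_cases hi : i ∈ s
      · obtain ⟨x, -, hx⟩ := exists_tendsto_of_mem_Icc q (f := fun n => ε i n / ε j n)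
          (a := -1) (b := 1) (by
            filter_upwards [hjmax, h0] with n h1 h2
            rw [Set.mem_Icc, ← abs_le, abs_div]
            exact div_le_one_of_le₀ (h1 i hi) (abs_nonneg _))
        exact ⟨x, fun _ => hx⟩
      · exact ⟨0, fun hi' => absurd hi' hi⟩
    choose ℓ hℓ using hlim
    have hℓj : ℓ j = 1 := by
      refine tendsto_nhds_unique (hℓ j hj) (tendsto_const_nhds.congr' ?_)
      filter_upwards [h0] with n hn
      rw [div_self hn]
    obtain ⟨σ, hσ⟩ := (GoodFun.sum s fun i => (hf i).const_mul (ℓ i)).exists_sign_eq h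
    obtain ⟨τ, hτ⟩ := exists_eventually_eq q (fun n => SignType.sign (ε j n))
    by_cases hσ0 : σ = 0
    · subst hσ0
      obtain ⟨ρ, hρ⟩ := ih (s.erase j) (fun i n => ε i n - ℓ i * ε j n)
        (by rw [Finset.card_erase_of_mem hj, hs]; rfl)
      refine ⟨ρ, ?_⟩
      filter_upwards [hσ, hρ] with m h1 h2
      filter_upwards [h2] with n h3
      rw [← h3]
      congr 1
      rw [sign_eq_zero_iff] at h1
      have h4 : ∑ i ∈ s, ε i n * f i m = ∑ i ∈ s, (ε i n - ℓ i * ε j n) * f i m := by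
        rw [← sub_eq_zero, ← Finset.sum_sub_distrib, ← mul_zero (ε j n), ← h1, Finset.mul_sum]
        exact Finset.sum_congr rfl fun i _ => by ring
      rw [h4, ← Finset.add_sum_erase s _ hj, hℓj]
      ring
    · refine ⟨σ * τ, ?_⟩
      filter_upwards [hσ] with m h1
      have h2 : Tendsto (fun n => ∑ i ∈ s, ε i n / ε j n * f i m) q (𝓝 (∑ i ∈ s, ℓ i * f i m)) :=
        tendsto_finsetSum _ fun i hi => (hℓ i hi).mul_const _
      have h3 : ∑ i ∈ s, ℓ i * f i m ≠ 0 := fun h0 => hσ0 (by rw [← h1, h0, sign_zero])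
      filter_upwards [eventually_sign_eq h3 h2, hτ, h0] with n h4 h5 h6
      rw [← h1, ← h4, ← h5, ← sign_mul, Finset.sum_mul]
      congr 1
      exact Finset.sum_congr rfl fun i _ => by field_simp

/-- Good functions taking integer values along `q` agree with an integer valued one. -/
theorem GoodFun.eventually_eq_floor_add_half (h : IsAdmissible q r) {p : ℕ → ℝ}
    (hp : GoodFun q p) (hlim : ∀ᶠ t in q, TendstoModOne (fun n => p (t * n)) q (p t))
    (hint : ∀ᶠ m in q, ∃ z : ℤ, p m = z) :
    GoodFun q (fun m => (⌊p m + 1 / 2⌋ : ℝ)) ∧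
      ∀ᶠ m in (q : Filter ℕ) ⊔ shift q r, p m = ⌊p m + 1 / 2⌋ := by
  have h1 : GoodFun q (fun m => (⌊p m + 1 / 2⌋ : ℝ)) := by
    refine (hp.add (GoodFun.const (1 / 2))).floor ?_ ?_
    · filter_upwards [hlim] with t ht ε hε
      filter_upwards [ht ε hε] with n ⟨z, hz⟩
      exact ⟨z, by convert hz using 2; ring⟩
    · filter_upwards [hint] with t ⟨z, hz⟩ w hw
      rw [hz] at hw
      have h2 : (2 * z + 1 : ℝ) = 2 * w := by linarith
      have h3 : 2 * z + 1 = 2 * w := by exact_mod_cast h2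
      omega
  have h2 : ∀ᶠ m in q, p m - ⌊p m + 1 / 2⌋ = 0 := by
    filter_upwards [hint] with m ⟨z, hz⟩
    rw [hz, sub_eq_zero, ← round_eq, round_intCast]
  exact ⟨h1, (eventually_sup.2 ⟨h2, (hp.sub h1).eventually_shift_eq_zero h h2⟩).mono
    fun m hm => sub_eq_zero.1 hm⟩

/-- Functions of two variables that are bilinear in integer valued good functions of `m` and
arbitrary functions of `n`. -/
def IsKernel (q : Ultrafilter ℕ) (r : ℕ → Ultrafilter ℕ) (Φ : ℕ → ℕ → ℝ) : Prop :=
  ∃ (ι : Type) (_ : Fintype ι) (c f : ι → ℕ → ℝ),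
    (∀ i, GoodFun q (f i)) ∧ (∀ i m, ∃ z : ℤ, f i m = z) ∧
      ∀ᶠ m in (q : Filter ℕ) ⊔ shift q r, ∀ᶠ n in q, Φ m n = ∑ i, c i n * f i m

theorem IsKernel.congr {Φ Ψ : ℕ → ℕ → ℝ} (hΦ : IsKernel q r Φ)
    (h : ∀ᶠ m in (q : Filter ℕ) ⊔ shift q r, ∀ᶠ n in q, Ψ m n = Φ m n) : IsKernel q r Ψ := by
  obtain ⟨ι, _, c, f, hf, hint, hsum⟩ := hΦ
  refine ⟨ι, inferInstance, c, f, hf, hint, ?_⟩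
  filter_upwards [h, hsum] with m h1 h2
  filter_upwards [h1, h2] with n h3 h4
  rw [h3, h4]

theorem IsKernel.of_mul (c : ℕ → ℝ) {f : ℕ → ℝ} (hf : GoodFun q f)
    (hint : ∀ m, ∃ z : ℤ, f m = z) : IsKernel q r (fun m n => c n * f m) :=
  ⟨Unit, inferInstance, fun _ => c, fun _ => f, fun _ => hf, fun _ => hint,
    Eventually.of_forall fun m => Eventually.of_forall fun n => by simp⟩

theorem IsKernel.const (c : ℝ) : IsKernel q r (fun _ _ => c) := by
  simpa using IsKernel.of_mul (q := q) (r := r) (fun _ => c) (GoodFun.const 1)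
    fun _ => ⟨1, by simp⟩

theorem IsKernel.of_good {f : ℕ → ℝ} (hf : GoodFun q f)
    (hint : ∀ m, ∃ z : ℤ, f m = z) : IsKernel q r (fun m _ => f m) := by
  simpa using IsKernel.of_mul (q := q) (r := r) (fun _ => 1) hf hint

theorem IsKernel.add {Φ Ψ : ℕ → ℕ → ℝ} (hΦ : IsKernel q r Φ) (hΨ : IsKernel q r Ψ) :
    IsKernel q r (fun m n => Φ m n + Ψ m n) := by
  obtain ⟨ι, _, c, f, hf, hint, hsum⟩ := hΦ
  obtain ⟨κ, _, d, g, hg, hint', hsum'⟩ := hΨ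
  refine ⟨ι ⊕ κ, inferInstance, Sum.elim c d, Sum.elim f g, ?_, ?_, ?_⟩
  · rintro (i | i)
    exacts [hf i, hg i]
  · rintro (i | i)
    exacts [hint i, hint' i]
  · filter_upwards [hsum, hsum'] with m h1 h2
    filter_upwards [h1, h2] with n h3 h4
    rw [h3, h4, Fintype.sum_sum_type]
    rfl

theorem IsKernel.mul {Φ Ψ : ℕ → ℕ → ℝ} (hΦ : IsKernel q r Φ) (hΨ : IsKernel q r Ψ) :
    IsKernel q r (fun m n => Φ m n * Ψ m n) := by
  obtain ⟨ι, _, c, f, hf, hint, hsum⟩ := hΦ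
  obtain ⟨κ, _, d, g, hg, hint', hsum'⟩ := hΨ
  refine ⟨ι × κ, inferInstance, fun i n => c i.1 n * d i.2 n, fun i m => f i.1 m * g i.2 m,
    fun i => (hf _).mul (hg _), fun i m => ?_, ?_⟩
  · obtain ⟨a, ha⟩ := hint i.1 m
    obtain ⟨b, hb⟩ := hint' i.2 m
    exact ⟨a * b, by simp [ha, hb]⟩
  · filter_upwards [hsum, hsum'] with m h1 h2
    filter_upwards [h1, h2] with n h3 h4
    rw [h3, h4, Fintype.sum_mul_sum, Fintype.sum_prod_type]
    exact Finset.sum_congr rfl fun i _ => Finset.sum_congr rfl fun j _ => by ring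

theorem IsKernel.sum {ι : Type*} (s : Finset ι) {Φ : ι → ℕ → ℕ → ℝ}
    (hΦ : ∀ i, IsKernel q r (Φ i)) : IsKernel q r (fun m n => ∑ i ∈ s, Φ i m n) := by
  classical
  induction s using Finset.induction_on with
  | empty => simpa using IsKernel.const (q := q) (r := r) 0
  | insert a s ha ih => simpa only [Finset.sum_insert ha] using (hΦ a).add ih

theorem TendstoModOne.of_mul (h : IsAdmissible q r) {g p : ℕ → ℝ}
    (hg : ∀ᶠ m in q, TendstoModOne (fun n => g (m * n)) q (p m)) :
    ∀ᶠ t in q, TendstoModOne (fun n => p (t * n)) q (p t) := by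
  filter_upwards [hg, h.mul_idem _ hg] with t h1 h2 ε hε
  filter_upwards [h.mul_idem _ (h1 (ε / 2) (by linarith)), h2] with N h3 h4
  obtain ⟨n, ⟨z, hz⟩, w, hw⟩ := (h3.and (h4 (ε / 2) (by linarith))).exists
  rw [← mul_assoc] at hz
  refine ⟨z - w, ?_⟩
  push_cast
  rw [abs_lt] at *
  constructor <;> linarith [hz.1, hz.2, hw.1, hw.2]

theorem IsKernel.floor (h : IsAdmissible q r) {g : ℕ → ℝ}
    (hg : IsKernel q r (fun m n => g (m * n))) :
    IsKernel q r (fun m n => (⌊g (m * n)⌋ : ℝ)) := by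
  obtain ⟨ι, _, c, f, hf, hint, hsum⟩ := hg
  choose F hF using hint
  choose θ _ hθ using fun i => exists_tendsto_of_mem_Icc q (f := fun n => Int.fract (c i n))
    (a := 0) (b := 1)
    (Eventually.of_forall fun n => ⟨Int.fract_nonneg _, (Int.fract_lt_one _).le⟩)
  set p : ℕ → ℝ := fun m => ∑ i, θ i * f i m with hpdef
  set η : ℕ → ℕ → ℝ := fun m n => ∑ i, (Int.fract (c i n) - θ i) * f i m with hηdef
  set K : ℕ → ℕ → ℤ := fun m n => ∑ i, ⌊c i n⌋ * F i m with hKdef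
  have hK : IsKernel q r (fun m n => (K m n : ℝ)) := by
    have := IsKernel.sum (r := r) Finset.univ fun i =>
      IsKernel.of_mul (r := r) (fun n => (⌊c i n⌋ : ℝ)) (hf i) fun m => ⟨F i m, hF i m⟩
    convert this using 3 with m n
    rw [hKdef]
    push_cast
    simp only [hF]
  have hp : GoodFun q p := GoodFun.sum _ fun i => (hf i).const_mul (θ i)
  have hη : ∀ m, Tendsto (η m) q (𝓝 0) := by
    intro m
    have := tendsto_finsetSum Finset.univ fun i _ =>
      ((hθ i).sub_const (θ i)).mul_const (f i m)
    simpa using this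
  have hdecomp : ∀ᶠ m in (q : Filter ℕ) ⊔ shift q r, ∀ᶠ n in q,
      g (m * n) = K m n + p m + η m n := by
    filter_upwards [hsum] with m h1
    filter_upwards [h1] with n h2
    rw [h2, hKdef, hpdef, hηdef]
    push_cast
    rw [← Finset.sum_add_distrib, ← Finset.sum_add_distrib]
    refine Finset.sum_congr rfl fun i _ => ?_
    rw [← hF, Int.fract]
    ring
  have hlim : ∀ᶠ t in q, TendstoModOne (fun n => p (t * n)) q (p t) := by
    refine TendstoModOne.of_mul h (g := g) ?_
    filter_upwards [(eventually_sup.1 hdecomp).1] with m h1 ε hε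
    filter_upwards [h1, Metric.tendsto_nhds.1 (hη m) ε hε] with n h2 h3
    refine ⟨K m n, ?_⟩
    rw [Real.dist_eq, sub_zero] at h3
    convert h3 using 2
    rw [h2]
    ring
  rcases q.em (fun m => ∃ z : ℤ, p m = z) with hpint | hpint
  · obtain ⟨hgood, heq⟩ := hp.eventually_eq_floor_add_half h hlim hpint
    obtain ⟨σ, hσ⟩ := exists_sign_sum_eq h Finset.univ (fun i n => Int.fract (c i n) - θ i) hf
    refine ((hK.add (IsKernel.of_good hgood fun m => ⟨_, rfl⟩)).add
      (IsKernel.const (if σ = -1 then -1 else 0))).congr ?_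
    filter_upwards [hdecomp, heq, hσ] with m h1 h2 h3
    filter_upwards [h1, h3, Metric.tendsto_nhds.1 (hη m) 1 one_pos] with n h4 h5 h6
    rw [Real.dist_eq, sub_zero, abs_lt] at h6
    have h7 : ⌊η m n⌋ = if σ = -1 then -1 else 0 := by
      split_ifs with h8
      · rw [h8, sign_eq_neg_one_iff] at h5
        rw [Int.floor_eq_iff]
        push_cast
        constructor
        · linarith [h6.1]
        · rw [neg_add_cancel]
          exact h5
      · have h9 : 0 ≤ η m n := by
          by_contra! h10
          exact h8 (by rw [← h5]; exact sign_neg h10)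
        rw [Int.floor_eq_iff]
        push_cast
        constructor <;> linarith [h6.2]
    generalize ⌊p m + 1 / 2⌋ = w at h2 ⊢
    rw [h4, h2, add_comm, ← Int.cast_add, Int.floor_add_intCast, h7]
    push_cast
    split_ifs <;> ring
  · have hne : ∀ᶠ m in q, ∀ z : ℤ, p m ≠ z := by
      filter_upwards [hpint] with m hm z hz using hm ⟨z, hz⟩
    have hne' : ∀ᶠ m in (q : Filter ℕ) ⊔ shift q r, ∀ z : ℤ, p m ≠ z := by
      rw [eventually_sup, eventually_shift]
      refine ⟨hne, ?_⟩
      filter_upwards [hp.tendstoModOne h, hne] with t h1 h2 using h1.ne_int h2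
    refine (hK.add (IsKernel.of_good (hp.floor hlim hne) fun m => ⟨_, rfl⟩)).congr ?_
    filter_upwards [hdecomp, hne'] with m h1 h2
    obtain ⟨δ, hδ, H⟩ := exists_pos_floor_eq h2
    filter_upwards [h1, Metric.tendsto_nhds.1 (hη m) δ hδ] with n h3 h4
    rw [Real.dist_eq, sub_zero] at h4
    rw [H (g (m * n)) (K m n) (by convert h4 using 2; rw [h3]; ring)]
    push_cast
    ring

theorem isKernel_of_isGenPoly (h : IsAdmissible q r) {F : (Fin 1 → ℝ) → ℝ} (hF : IsGenPoly F) :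
    IsKernel q r (fun m n => F (fun _ => ((m * n : ℕ) : ℝ))) := by
  induction hF with
  | coord i =>
    refine (IsKernel.of_mul (fun n => (n : ℝ)) GoodFun.id fun m => ⟨m, by simp⟩).congr ?_
    refine Eventually.of_forall fun m => Eventually.of_forall fun n => ?_
    push_cast
    ring
  | const c => exact IsKernel.const c
  | add _ _ h1 h2 => exact h1.add h2
  | mul _ _ h1 h2 => exact h1.mul h2
  | @intPart f _ ih => exact IsKernel.floor h (g := fun n => f (fun _ => (n : ℝ))) ih

/-- If a generalised polynomial vanishes along `q`, then for `shift q r`-most `m`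
it vanishes at `m * n` for `q`-most `n`. -/
theorem eventually_shift_mul_eq_zero (h : IsAdmissible q r) {g : ℕ → ℝ} (hg : IsGenPolyNat g)
    (h0 : ∀ᶠ n in q, g n = 0) : ∀ᶠ m in shift q r, ∀ᶠ n in q, g (m * n) = 0 := by
  obtain ⟨F, hF, hgF⟩ := hg
  obtain ⟨ι, _, c, f, hf, -, hsum⟩ := isKernel_of_isGenPoly h hF
  obtain ⟨σ, hσ⟩ := exists_sign_sum_eq h Finset.univ c hf
  have key : ∀ᶠ m in (q : Filter ℕ) ⊔ shift q r, ∀ᶠ n in q,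
      SignType.sign (g (m * n)) = σ := by
    filter_upwards [hσ, hsum] with m h1 h2
    filter_upwards [h1, h2] with n h3 h4
    rw [hgF, h4, h3]
  rw [eventually_sup] at key
  obtain ⟨m, h1, h2⟩ := (key.1.and (h.mul_idem _ h0)).exists
  obtain ⟨n, h3, h4⟩ := (h1.and h2).exists
  rw [h4, sign_zero] at h3
  filter_upwards [key.2] with m hm
  filter_upwards [hm] with n hn
  rwa [← h3, sign_eq_zero_iff] at hn

end Ultra

section Existence

open Hindman

attribute [local instance] Ultrafilter.mul Ultrafilter.add Ultrafilter.semigroup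
  Ultrafilter.addSemigroup

theorem exists_pow_of_mem_FP_const {k m : ℕ} (hm : m ∈ FP (Stream'.const k)) :
    ∃ j, m = k ^ (j + 1) := by
  generalize hs : Stream'.const k = s at hm
  induction hm with
  | head' a => exact ⟨0, by rw [← hs]; exact (pow_one k).symm⟩
  | tail' a m _ ih => exact ih (by rw [← hs, Stream'.tail_const])
  | cons' a m _ ih =>
    obtain ⟨j, hj⟩ := ih (by rw [← hs, Stream'.tail_const])
    refine ⟨j + 1, ?_⟩
    rw [hj, ← hs, pow_succ' k (j + 1)]
    rfl

theorem exists_sum_of_mem_FS {a : Stream' ℕ} {m : ℕ} (hm : m ∈ Hindman.FS a) :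
    ∃ I : Finset ℕ, I.Nonempty ∧ m = ∑ i ∈ I, a.get i := by
  induction hm with
  | head' a => exact ⟨{0}, Finset.singleton_nonempty _, by simp [Stream'.head]⟩
  | tail' a m _ ih =>
    obtain ⟨I, hI, rfl⟩ := ih
    exact ⟨I.map (addRightEmbedding 1), hI.map, by simp⟩
  | cons' a m _ ih =>
    obtain ⟨I, hI, rfl⟩ := ih
    refine ⟨insert 0 (I.map (addRightEmbedding 1)), Finset.insert_nonempty _ _, ?_⟩
    rw [Finset.sum_insert (by simp)]
    simp [Stream'.head]

theorem exists_mul_idem_ultrafilter {k : ℕ} (hk : 2 ≤ k) :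
    ∃ q : Ultrafilter ℕ,
      (∀ φ : ℕ → Prop, (∀ᶠ n in q, φ n) → ∀ᶠ m in q, ∀ᶠ n in q, φ (m * n)) ∧
      (q : Filter ℕ) ≤ atTop ∧ ∀ᶠ n in q, ∃ j, n = k ^ j := by
  obtain ⟨U, hU, hmem⟩ := exists_idempotent_ultrafilter_le_FP (Stream'.const k)
  have hiff : ∀ φ : ℕ → Prop, (∀ᶠ n in U, φ n) ↔ ∀ᶠ m in U, ∀ᶠ n in U, φ (m * n) := fun φ => by
    conv_lhs => rw [← hU]
    exact Ultrafilter.eventually_mul U U φ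
  have hpow : ∀ᶠ n in U, ∃ j, n = k ^ (j + 1) :=
    hmem.mono fun _ hn => exists_pow_of_mem_FP_const hn
  have h2 : ∀ᶠ n in U, 2 ≤ n := by
    filter_upwards [hpow] with n ⟨j, hj⟩
    rw [hj]
    exact hk.trans (Nat.le_self_pow (Nat.succ_ne_zero j) k)
  refine ⟨U, fun φ => (hiff φ).1, fun s hs => ?_, hpow.mono fun n ⟨j, hj⟩ => ⟨j + 1, hj⟩⟩
  obtain ⟨B, hB⟩ := mem_atTop_sets.1 hs
  suffices H : ∀ᶠ n in U, B ≤ n from H.mono hB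
  clear hB
  induction B with
  | zero => exact Eventually.of_forall Nat.zero_le
  | succ B ih =>
    rw [hiff]
    filter_upwards [h2] with m hm
    filter_upwards [ih, h2] with n h3 h4
    nlinarith

theorem exists_add_idem_ultrafilter {a : ℕ → ℕ} (ha : ∀ i, 0 < a i) :
    ∃ u : Ultrafilter ℕ, AddIdem u ∧ (u : Filter ℕ) ≤ atTop ∧ ∀ᶠ n in u, n ∈ _root_.FS a := by
  obtain ⟨U, hU, hmem⟩ := exists_idempotent_ultrafilter_le_FS (a : Stream' ℕ)
  have hiff : ∀ φ : ℕ → Prop, (∀ᶠ n in U, φ n) ↔ ∀ᶠ m in U, ∀ᶠ n in U, φ (m + n) := fun φ => by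
    conv_lhs => rw [← hU]
    exact Ultrafilter.eventually_add U U φ
  have hFS : ∀ᶠ n in U, n ∈ _root_.FS a := hmem.mono fun _ hn => exists_sum_of_mem_FS hn
  have h1 : ∀ᶠ n in U, 1 ≤ n := by
    filter_upwards [hFS] with n ⟨I, hI, hn⟩
    rw [hn]
    exact Finset.sum_pos (fun i _ => ha i) hI
  refine ⟨U, fun φ => (hiff φ).1, fun s hs => ?_, hFS⟩
  obtain ⟨B, hB⟩ := mem_atTop_sets.1 hs
  suffices H : ∀ᶠ n in U, B ≤ n from H.mono hB
  clear hB
  induction B with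
  | zero => exact Eventually.of_forall Nat.zero_le
  | succ B ih =>
    rw [hiff]
    filter_upwards [h1] with m hm
    filter_upwards [ih] with n h3
    omega

end Existence

end GenPolyPowers

/-- If `k ≥ 2` and `E ⊆ ℕ` is a generalised polynomial set containing
all powers of `k`, then the set of `m` such that `m·kⁿ ∈ E` for infinitely many `n`
is IP*₊. -/
theorem genPolySet_powers_IPStarPlus (k : ℕ) (hk : 2 ≤ k) (E : Set ℕ)
    (hE : IsGenPolySet E) (hpow : ∀ n : ℕ, k ^ n ∈ E) :
    IsIPStarPlus {m : ℕ | {n : ℕ | m * k ^ n ∈ E}.Infinite} := by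
  by_contra hcon
  simp only [IsIPStarPlus, IsIPStar, not_exists, not_forall] at hcon
  choose A hA hdisj using fun t : ℕ => hcon t
  choose a ha hFS using hA
  obtain ⟨q, hmul, hq, hqpow⟩ := GenPolyPowers.exists_mul_idem_ultrafilter hk
  choose r hadd hr hrFS using fun t => GenPolyPowers.exists_add_idem_ultrafilter (ha t)
  obtain ⟨g, hg, rfl⟩ := hE
  have h0 : ∀ᶠ n in q, g n = 0 := by
    filter_upwards [hqpow] with n ⟨j, hj⟩
    rw [hj]
    exact hpow j
  have hmain := GenPolyPowers.eventually_shift_mul_eq_zero ⟨hmul, hq, hadd, hr⟩ hg h0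
  obtain ⟨t, ht⟩ := (GenPolyPowers.eventually_shift.1 hmain).exists
  obtain ⟨R, hR, hRFS⟩ := (ht.and (hrFS t)).exists
  refine hdisj t ⟨R, ⟨t + R, fun hfin => ?_, by push_cast; ring⟩, hFS t hRFS⟩
  obtain ⟨B, hB⟩ := (hfin.image (k ^ ·)).bddAbove
  obtain ⟨n, ⟨hn, j, rfl⟩, hnB⟩ := ((hR.and hqpow).and (hq (eventually_gt_atTop B))).exists
  exact absurd (hB ⟨j, hn, rfl⟩) (not_le.2 hnB)
end

section
/- For any integer k ≥ 2, the set {kⁿ : n ≥ 0} of powers of k is not a generalised polynomial set; that is, there is no generalised polynomial g : ℕ → ℝ such that g(n) = 0 if and only if n is a power of k. -/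
open Filter Topology
open scoped Matrix Kronecker

/-- Multiplicative idempotence of an ultrafilter on `ℕ`. -/
def MulIdem (p : Ultrafilter ℕ) : Prop :=
  ∀ Q : ℕ → Prop, (∀ᶠ n in p, Q n) ↔
    ∀ᶠ a in p, ∀ᶠ b in p, Q (a * b)

/-- Additive idempotence of an ultrafilter on `ℕ`. -/
def AddIdem (r : Ultrafilter ℕ) : Prop :=
  ∀ Q : ℕ → Prop, (∀ᶠ n in r, Q n) ↔
    ∀ᶠ a in r, ∀ᶠ b in r, Q (a + b)

theorem exists_idempotent_pnat :
    ∃ U : Ultrafilter ℕ+, ∀ Q : ℕ+ → Prop, (∀ᶠ n in U, Q n) ↔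
      ∀ᶠ a in U, ∀ᶠ b in U, Q (a + b) := by
  let _ : AddSemigroup (Ultrafilter ℕ+) := Ultrafilter.addSemigroup
  obtain ⟨U, hU⟩ := exists_idempotent_of_compact_t2_of_continuous_add_left
    (M := Ultrafilter ℕ+) Ultrafilter.continuous_add_left
  refine ⟨U, fun Q => ?_⟩
  rw [← Ultrafilter.eventually_add U U Q]
  exact Eq.to_iff (congrArg (fun V : Ultrafilter ℕ+ => ∀ᶠ n in V, Q n) hU.symm)

theorem exists_addIdem : ∃ r : Ultrafilter ℕ, AddIdem r ∧ ∀ᶠ s in r, 0 < s := by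
  obtain ⟨U, hU⟩ := exists_idempotent_pnat
  refine ⟨U.map (fun e : ℕ+ => (e : ℕ)), fun Q => ?_, ?_⟩
  · exact hU (fun e => Q e)
  · exact Eventually.of_forall (f := (U : Filter ℕ+)) fun e : ℕ+ => e.pos

theorem exists_mulIdem (k : ℕ) (hk : 2 ≤ k) :
    ∃ p : Ultrafilter ℕ, MulIdem p ∧ (∀ᶠ n in p, ∃ i, n = k ^ i) ∧
      Tendsto (fun n : ℕ => n) p atTop := by
  obtain ⟨U, hU⟩ := exists_idempotent_pnat
  have hlarge : ∀ m : ℕ, ∀ᶠ e : ℕ+ in U, m ≤ (e : ℕ) := by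
    intro m
    induction m with
    | zero => simp
    | succ m ih =>
      rw [hU]
      filter_upwards [ih] with a ha
      refine Eventually.of_forall fun b => ?_
      have := b.pos
      rw [PNat.add_coe]; omega
  refine ⟨U.map (fun e : ℕ+ => k ^ (e : ℕ)), fun Q => ?_, ?_, ?_⟩
  · have h := hU (fun e => Q (k ^ (e : ℕ)))
    simp only [PNat.add_coe, pow_add] at h
    exact h
  · exact Eventually.of_forall (f := (U : Filter ℕ+)) fun e : ℕ+ => ⟨(e : ℕ), rfl⟩
  · refine tendsto_atTop.2 fun m => ?_
    change ∀ᶠ e : ℕ+ in U, m ≤ k ^ (e : ℕ)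
    filter_upwards [hlarge m] with e he
    exact he.trans (Nat.lt_pow_self (by omega)).le

theorem AddIdem.eventually_dvd {r : Ultrafilter ℕ} (hr : AddIdem r) {m : ℕ} (hm : 0 < m) :
    ∀ᶠ s in r, m ∣ s := by
  have : NeZero m := ⟨hm.ne'⟩
  obtain ⟨c, hc⟩ : ∃ c : ZMod m, ∀ᶠ s : ℕ in r, (s : ZMod m) = c := by
    have h := (Ultrafilter.eventually_exists_iff (f := r)
      (P := fun (c : ZMod m) (s : ℕ) => (s : ZMod m) = c)).1 (Eventually.of_forall fun s => ⟨_, rfl⟩)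
    exact h
  have h2 := (hr _).1 hc
  obtain ⟨a, ha, ha'⟩ := (h2.and hc).exists
  obtain ⟨b, hb, hb'⟩ := (ha.and hc).exists
  have hc0 : c = 0 := by
    push_cast at hb
    rw [ha', hb'] at hb
    simpa using hb
  filter_upwards [hc] with s hs
  rwa [hc0, ZMod.natCast_eq_zero_iff] at hs

theorem exists_tendsto_of_abs_le {u : Ultrafilter ℕ} {f : ℕ → ℝ} {C : ℝ}
    (h : ∀ᶠ n in u, |f n| ≤ C) : ∃ x, |x| ≤ C ∧ Tendsto f u (𝓝 x) := by
  obtain ⟨x, hx, hx'⟩ := (isCompact_Icc (a := -C) (b := C)).ultrafilter_le_nhds (u.map f)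
    (le_principal_iff.2 (by
      change ∀ᶠ n in u, f n ∈ Set.Icc (-C) C
      filter_upwards [h] with n hn using abs_le.1 hn))
  exact ⟨x, abs_le.2 hx, hx'⟩

theorem MulIdem.tendsto_of_iterate {p : Ultrafilter ℕ} (hp : MulIdem p) {X : Type*}
    [TopologicalSpace X] [RegularSpace X] {F G : ℕ → X} {x : X} (hF : Tendsto F p (𝓝 x))
    (hG : ∀ᶠ a in p, Tendsto (fun N => F (a * N)) p (𝓝 (G a))) : Tendsto G p (𝓝 x) := by
  refine (closed_nhds_basis x).tendsto_right_iff.2 fun s hs => ?_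
  filter_upwards [(hp _).1 (hF.eventually_mem hs.1), hG] with a ha ha'
  exact hs.2.mem_of_tendsto ha' ha

theorem AddIdem.tendsto_of_iterate {r : Ultrafilter ℕ} (hr : AddIdem r) {X : Type*}
    [TopologicalSpace X] [RegularSpace X] {F G : ℕ → X} {x : X} (hF : Tendsto F r (𝓝 x))
    (hG : ∀ᶠ a in r, Tendsto (fun s => F (a + s)) r (𝓝 (G a))) : Tendsto G r (𝓝 x) := by
  refine (closed_nhds_basis x).tendsto_right_iff.2 fun s hs => ?_
  filter_upwards [(hr _).1 (hF.eventually_mem hs.1), hG] with a ha ha'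
  exact hs.2.mem_of_tendsto ha' ha

/-- An integer-valued function that converges in `ℝ` is eventually constant. -/
theorem eventually_eq_of_tendsto_intCast {α : Type*} {l : Filter α} [NeBot l] {f : α → ℤ} {x : ℝ}
    (h : Tendsto (fun n => (f n : ℝ)) l (𝓝 x)) : ∃ m : ℤ, x = m ∧ ∀ᶠ n in l, f n = m := by
  obtain ⟨m, rfl⟩ := Int.isClosedEmbedding_coe_real.isClosed_range.mem_of_tendsto h
    (Eventually.of_forall fun n => ⟨f n, rfl⟩)
  refine ⟨m, rfl, ?_⟩
  have h' : Tendsto f l (𝓝 m) :=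
    Int.isClosedEmbedding_coe_real.isEmbedding.tendsto_nhds_iff.2 h
  simpa using h'

theorem eventually_eq_zero_of_tendsto_intCast {α : Type*} {l : Filter α} [NeBot l] {f : α → ℤ}
    (h : Tendsto (fun n => (f n : ℝ)) l (𝓝 0)) : ∀ᶠ n in l, f n = 0 := by
  obtain ⟨m, hm, h⟩ := eventually_eq_of_tendsto_intCast h
  have : m = 0 := by exact_mod_cast hm.symm
  simpa [this] using h

/-- Polynomials of rank at most `k` along the additively idempotent ultrafilter `r`. -/
def IPPoly (r : Ultrafilter ℕ) : ℕ → (ℕ → ℤ) → Prop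
  | 0, f => ∀ᶠ s in r, f s = 0
  | k + 1, f => ∀ᶠ s' in r, ∃ m, IPPoly r k m ∧ ∀ᶠ s in r, f (s' + s) = f s' + f s + m s

section IPPoly
variable {r : Ultrafilter ℕ}

theorem IPPoly.congr (hr : AddIdem r) : ∀ {k : ℕ} {f g : ℕ → ℤ}, IPPoly r k f →
    (∀ᶠ s in r, g s = f s) → IPPoly r k g
  | 0, f, g, hf, hg => by
    filter_upwards [hf, hg] with s h1 h2 using h2.trans h1
  | k + 1, f, g, hf, hg => by
    filter_upwards [hf, hg, (hr _).1 hg] with s' ⟨m, hm, h1⟩ h2 h3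
    refine ⟨m, hm, ?_⟩
    filter_upwards [h1, h3, hg] with s h4 h5 h6
    rw [h5, h4, h2, h6]

theorem IPPoly.const_mul (c : ℤ) : ∀ {k : ℕ} {f : ℕ → ℤ}, IPPoly r k f →
    IPPoly r k (fun s => c * f s)
  | 0, f, hf => by
    filter_upwards [hf] with s h1
    simp [h1]
  | k + 1, f, hf => by
    filter_upwards [hf] with s' ⟨m, hm, h1⟩
    refine ⟨_, hm.const_mul c, ?_⟩
    filter_upwards [h1] with s h4
    rw [h4]; ring

theorem IPPoly.add : ∀ {k : ℕ} {f g : ℕ → ℤ}, IPPoly r k f → IPPoly r k g →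
    IPPoly r k (fun s => f s + g s)
  | 0, f, g, hf, hg => by
    filter_upwards [hf, hg] with s h1 h2
    simp [h1, h2]
  | k + 1, f, g, hf, hg => by
    filter_upwards [hf, hg] with s' ⟨m, hm, h1⟩ ⟨l, hl, h2⟩
    refine ⟨_, hm.add hl, ?_⟩
    filter_upwards [h1, h2] with s h3 h4
    rw [h3, h4]; ring

theorem IPPoly.zero : ∀ k : ℕ, IPPoly r k (fun _ => 0)
  | 0 => Eventually.of_forall fun _ => rfl
  | k + 1 => Eventually.of_forall fun _ => ⟨_, IPPoly.zero k, by simp⟩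

theorem IPPoly.succ (hr : AddIdem r) : ∀ {k : ℕ} {f : ℕ → ℤ}, IPPoly r k f → IPPoly r (k + 1) f
  | 0, f, hf => (IPPoly.zero 1).congr hr hf
  | k + 1, f, hf => by
    change ∀ᶠ s' : ℕ in r, _
    filter_upwards [hf] with s' ⟨m, hm, h1⟩ using ⟨m, hm.succ hr, h1⟩

theorem IPPoly.mono (hr : AddIdem r) {k l : ℕ} (h : k ≤ l) {f : ℕ → ℤ} (hf : IPPoly r k f) :
    IPPoly r l f := by
  induction h with
  | refl => exact hf
  | step _ ih => exact ih.succ hr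

theorem IPPoly.mul (hr : AddIdem r) {i j : ℕ} {f g : ℕ → ℤ} (hf : IPPoly r i f)
    (hg : IPPoly r j g) : IPPoly r (i + j) (fun s => f s * g s) := by
  induction hn : i + j using Nat.strong_induction_on generalizing i j f g with
  | _ n ih =>
  subst hn
  match i, j with
  | 0, j =>
    refine IPPoly.mono hr (Nat.zero_le _) ?_
    filter_upwards [hf] with s h1
    simp [h1]
  | i + 1, 0 =>
    refine IPPoly.mono hr (Nat.zero_le _) ?_
    filter_upwards [hg] with s h1
    simp [h1]
  | i + 1, j + 1 =>
    rw [show i + 1 + (j + 1) = (i + j + 1) + 1 by ring] at *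
    change ∀ᶠ s' : ℕ in r, _
    filter_upwards [hf, hg] with s' ⟨m, hm, h1⟩ ⟨l, hl, h2⟩
    have hf' : IPPoly r (i + j + 1) f := hf.mono hr (by omega)
    have hg' : IPPoly r (i + j + 1) g := hg.mono hr (by omega)
    have hm' : IPPoly r (i + j + 1) m := hm.mono hr (by omega)
    have hl' : IPPoly r (i + j + 1) l := hl.mono hr (by omega)
    have hfl := (ih _ (by omega) hf hl rfl).mono hr (show i + 1 + j ≤ i + j + 1 by omega)
    have hmg := (ih _ (by omega) hm hg rfl).mono hr (show i + (j + 1) ≤ i + j + 1 by omega)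
    have hml := (ih _ (by omega) hm hl rfl).mono hr (show i + j ≤ i + j + 1 by omega)
    refine ⟨_, ((((hg'.add hl').const_mul (f s')).add ((hf'.add hm').const_mul (g s'))).add
      (hfl.add hmg)).add hml, ?_⟩
    filter_upwards [h1, h2] with s h3 h4
    rw [h3, h4]; ring

theorem IPPoly.tendsto_unitAddCircle (hr : AddIdem r) (α : ℝ) : ∀ {k : ℕ} {f : ℕ → ℤ},
    IPPoly r k f → Tendsto (fun s => ((α * f s : ℝ) : UnitAddCircle)) r (𝓝 0)
  | 0, f, hf => by
    refine tendsto_const_nhds.congr' ?_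
    filter_upwards [hf] with s hs
    simp [hs]
  | k + 1, f, hf => by
    obtain ⟨x, -, hx⟩ := (isCompact_univ (X := UnitAddCircle)).ultrafilter_le_nhds
      (r.map (fun s => ((α * f s : ℝ) : UnitAddCircle))) (by simp)
    have hx : Tendsto (fun s => ((α * f s : ℝ) : UnitAddCircle)) r (𝓝 x) := hx
    have h2 := hr.tendsto_of_iterate (G := fun s' => ((α * f s' : ℝ) : UnitAddCircle) + x + 0) hx
      (by
        filter_upwards [hf] with s' ⟨m, hm, h1⟩
        refine ((hx.const_add _).add (hm.tendsto_unitAddCircle hr α)).congr' ?_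
        filter_upwards [h1] with s hs
        rw [hs]
        push_cast
        rw [← AddCircle.coe_add, ← AddCircle.coe_add]
        ring_nf)
    have h3 := tendsto_nhds_unique h2 ((hx.add_const x).add_const 0)
    have : x = 0 := by simpa using h3
    exact this ▸ hx

theorem IPPoly.tendsto_sub_round (hr : AddIdem r) {ι : Type*} [Fintype ι] (ψ : ι → ℝ)
    {k : ℕ} {f : ι → ℕ → ℤ} (hf : ∀ c, IPPoly r k (f c)) :
    Tendsto (fun s => ∑ c, ψ c * f c s - round (∑ c, ψ c * f c s)) r (𝓝 0) := by
  have h1 : Tendsto (fun s => ∑ c, ((ψ c * f c s : ℝ) : UnitAddCircle)) r (𝓝 (∑ _c : ι, 0)) :=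
    tendsto_finsetSum _ fun c _ => (hf c).tendsto_unitAddCircle hr (ψ c)
  rw [Finset.sum_const_zero] at h1
  have h2 := h1.norm
  rw [norm_zero] at h2
  rw [tendsto_zero_iff_abs_tendsto_zero]
  refine h2.congr fun s => ?_
  have : ∑ c, ((ψ c * f c s : ℝ) : UnitAddCircle) = ((∑ c, ψ c * f c s : ℝ) : UnitAddCircle) :=
    (map_sum (QuotientAddGroup.mk' (AddSubgroup.zmultiples (1 : ℝ))) _ _).symm
  rw [this, UnitAddCircle.norm_eq]; rfl

theorem IPPoly.round (hr : AddIdem r) {ι : Type*} [Fintype ι] (ψ : ι → ℝ) : ∀ {k : ℕ}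
    {f : ι → ℕ → ℤ}, (∀ c, IPPoly r k (f c)) →
    IPPoly r k (fun s => round (∑ c, ψ c * f c s))
  | 0, f, hf => by
    filter_upwards [eventually_all.2 hf] with s hs
    simp [hs]
  | k + 1, f, hf => by
    have hsmall := (IPPoly.tendsto_sub_round hr ψ hf).eventually
      (Metric.ball_mem_nhds 0 (ε := 1 / 8) (by norm_num))
    change ∀ᶠ s' : ℕ in r, _
    filter_upwards [eventually_all.2 hf, hsmall, (hr _).1 hsmall] with s' h1 h2 h3
    choose m hm h1 using h1
    refine ⟨_, IPPoly.round hr ψ hm, ?_⟩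
    filter_upwards [eventually_all.2 h1, hsmall, h3, (IPPoly.tendsto_sub_round hr ψ hm).eventually
      (Metric.ball_mem_nhds 0 (ε := 1 / 8) (by norm_num))] with s h4 h5 h6 h7
    have key : ∑ c, ψ c * f c (s' + s) =
        ∑ c, ψ c * f c s' + ∑ c, ψ c * f c s + ∑ c, ψ c * m c s := by
      rw [← Finset.sum_add_distrib, ← Finset.sum_add_distrib]
      refine Finset.sum_congr rfl fun c _ => ?_
      rw [h4 c]; push_cast; ring
    rw [Real.dist_0_eq_abs, abs_lt] at h2 h5 h6 h7
    rw [← sub_eq_zero, ← Int.abs_lt_one_iff, ← Int.cast_lt (R := ℝ), Int.cast_abs, abs_lt]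
    push_cast
    constructor <;> linarith [h2.1, h2.2, h5.1, h5.2, h6.1, h6.2, h7.1, h7.2]

end IPPoly

/-- The distribution of the products `(a + s) * N` with `N`, `s`, `a` tending along `p`, `r`, `p`
in this order. -/
def shiftFilter (p r : Ultrafilter ℕ) : Filter ℕ :=
  (p : Filter ℕ).bind fun a => (r : Filter ℕ).bind fun s => map (fun N => (a + s) * N) p

theorem eventually_shiftFilter {p r : Ultrafilter ℕ} {Q : ℕ → Prop} :
    (∀ᶠ n in shiftFilter p r, Q n) ↔ ∀ᶠ a in p, ∀ᶠ s in r, ∀ᶠ N in p, Q ((a + s) * N) :=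
  Iff.rfl

/-- A vector `M` of integer-valued functions on `ℕ` such that `M (t * N)` is, for `N` large along
`p`, a linear image `H t *ᵥ M N` of `M N`, with a controlled dependence of `H` on `t`. -/
structure LimitSystem (p r : Ultrafilter ℕ) (ι : Type) [Fintype ι] [DecidableEq ι] where
  /-- degrees -/
  d : ι → ℕ
  /-- the functions -/
  M : ℕ → ι → ℤ
  /-- the transition matrices -/
  H : ℕ → Matrix ι ι ℤ
  /-- the left factor of the transition matrices -/
  K : ℕ → Matrix ι ι ℝ
  /-- the right factor of the transition matrices -/
  Th : Matrix ι ι ℝ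
  /-- the index of the constant function -/
  i₀ : ι
  M_mul : ∀ t, ∀ᶠ N in p, M (t * N) = H t *ᵥ M N
  H_eq : ∀ t, (H t).map (Int.cast : ℤ → ℝ) =
    K t * Matrix.diagonal (fun c => (t : ℝ) ^ d c) * Th
  H_mul : ∀ t, ∀ᶠ N in p, H (t * N) = H t * H N
  K_mul : ∀ t b c, Tendsto (fun N => K (t * N) b c) p (𝓝 (K t b c))
  H_add : ∀ᶠ a in p, ∀ b c, ∃ k, IPPoly r k fun s => H (a + s) b c - H a b c
  K_add : ∀ᶠ a in p, ∀ b c, Tendsto (fun s => K (a + s) b c) r (𝓝 (K a b c))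
  dvd : ∀ (t : ℕ) (b c), (t : ℤ) ^ d c ∣ H t b c
  Th_tri : ∀ b c, d b < d c → Th b c = 0
  K_tri : ∀ b c, d b < d c → K 1 b c = 0
  K_mul_Th : K 1 * Th = 1
  d_zero : d i₀ = 0
  M_one : ∀ n, M n i₀ = 1
  H_row : ∀ t, H t i₀ = Pi.single i₀ 1
  K_row : ∀ t, K t i₀ = Pi.single i₀ 1
  Th_row : Th i₀ = Pi.single i₀ 1

namespace LimitSystem
variable {p r : Ultrafilter ℕ} {ι κ : Type} [Fintype ι] [DecidableEq ι] [Fintype κ]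
  [DecidableEq κ]

/-- The system consisting of the functions `1` and `n`. -/
def base (p r : Ultrafilter ℕ) : LimitSystem p r (Fin 2) where
  d := ![0, 1]
  M n := ![1, n]
  H t := Matrix.diagonal ![1, t]
  K _ := 1
  Th := 1
  i₀ := 0
  M_mul t := Eventually.of_forall fun N => by
    ext b; fin_cases b <;> simp [Matrix.mulVec_diagonal]
  H_eq t := by ext b c; fin_cases b <;> fin_cases c <;> simp
  H_mul t := Eventually.of_forall fun N => by
    ext b c; fin_cases b <;> fin_cases c <;> simp
  K_mul t b c := tendsto_const_nhds
  H_add := Eventually.of_forall fun a b c => by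
    have h0 : ∃ k, IPPoly r k fun _ => 0 := ⟨0, IPPoly.zero 0⟩
    have h1 : ∃ k, IPPoly r k fun s => (s : ℤ) :=
      ⟨1, Eventually.of_forall fun s' => ⟨_, IPPoly.zero 0, by simp⟩⟩
    fin_cases b <;> fin_cases c <;> simp [h0, h1]
  K_add := Eventually.of_forall fun a b c => tendsto_const_nhds
  dvd t b c := by fin_cases b <;> fin_cases c <;> simp
  Th_tri b c := by fin_cases b <;> fin_cases c <;> simp
  K_tri b c := by fin_cases b <;> fin_cases c <;> simp
  K_mul_Th := one_mul 1
  d_zero := rfl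
  M_one n := rfl
  H_row t := by ext c; fin_cases c <;> simp
  K_row t := by ext c; simp [Matrix.one_apply, Pi.single_apply, eq_comm]
  Th_row := by ext c; simp [Matrix.one_apply, Pi.single_apply, eq_comm]

/-- The system of pairwise products of the functions of two systems. -/
def tensor (hr : AddIdem r) (S : LimitSystem p r ι) (T : LimitSystem p r κ) :
    LimitSystem p r (ι × κ) where
  d b := S.d b.1 + T.d b.2
  M n b := S.M n b.1 * T.M n b.2
  H t := S.H t ⊗ₖ T.H t
  K t := S.K t ⊗ₖ T.K t
  Th := S.Th ⊗ₖ T.Th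
  i₀ := (S.i₀, T.i₀)
  M_mul t := by
    filter_upwards [S.M_mul t, T.M_mul t] with N h1 h2
    ext ⟨b, b'⟩
    simp only [h1, h2, Matrix.mulVec, dotProduct, Matrix.kroneckerMap_apply,
      Fintype.sum_prod_type, Finset.sum_mul_sum]
    exact Finset.sum_congr rfl fun _ _ => Finset.sum_congr rfl fun _ _ => by ring
  H_eq t := by
    have h : (Matrix.diagonal fun b : ι × κ => (t : ℝ) ^ (S.d b.1 + T.d b.2)) =
        Matrix.diagonal (fun b => (t : ℝ) ^ S.d b) ⊗ₖ Matrix.diagonal fun b => (t : ℝ) ^ T.d b := by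
      rw [Matrix.diagonal_kronecker_diagonal]
      simp only [pow_add]
    rw [h, ← Matrix.mul_kronecker_mul, ← Matrix.mul_kronecker_mul, ← S.H_eq, ← T.H_eq]
    ext b c; simp
  H_mul t := by
    filter_upwards [S.H_mul t, T.H_mul t] with N h1 h2
    rw [h1, h2, Matrix.mul_kronecker_mul]
  K_mul t b c := (S.K_mul t b.1 c.1).mul (T.K_mul t b.2 c.2)
  H_add := by
    filter_upwards [S.H_add, T.H_add] with a h1 h2 b c
    obtain ⟨k, hk⟩ := h1 b.1 c.1
    obtain ⟨l, hl⟩ := h2 b.2 c.2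
    refine ⟨k + l, (((hk.mul hr hl).add ((hl.mono hr (Nat.le_add_left l k)).const_mul
      (S.H a b.1 c.1))).add ((hk.mono hr (Nat.le_add_right k l)).const_mul
      (T.H a b.2 c.2))).congr hr (Eventually.of_forall fun s => ?_)⟩
    simp only [Matrix.kroneckerMap_apply]; ring
  K_add := by
    filter_upwards [S.K_add, T.K_add] with a h1 h2 b c
    exact (h1 b.1 c.1).mul (h2 b.2 c.2)
  dvd t b c := by
    rw [pow_add]; exact mul_dvd_mul (S.dvd t _ _) (T.dvd t _ _)
  Th_tri b c h := by
    rcases (show S.d b.1 < S.d c.1 ∨ T.d b.2 < T.d c.2 by omega) with h | h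
    · simp [S.Th_tri _ _ h]
    · simp [T.Th_tri _ _ h]
  K_tri b c h := by
    rcases (show S.d b.1 < S.d c.1 ∨ T.d b.2 < T.d c.2 by omega) with h | h
    · simp [S.K_tri _ _ h]
    · simp [T.K_tri _ _ h]
  K_mul_Th := by
    rw [← Matrix.mul_kronecker_mul, S.K_mul_Th, T.K_mul_Th, Matrix.one_kronecker_one]
  d_zero := by simp [S.d_zero, T.d_zero]
  M_one n := by simp [S.M_one, T.M_one]
  H_row t := by
    ext c
    simp only [Matrix.kroneckerMap_apply, S.H_row, T.H_row, Pi.single_apply, Prod.ext_iff]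
    split_ifs <;> simp_all
  K_row t := by
    ext c
    simp only [Matrix.kroneckerMap_apply, S.K_row, T.K_row, Pi.single_apply, Prod.ext_iff]
    split_ifs <;> simp_all
  Th_row := by
    ext c
    simp only [Matrix.kroneckerMap_apply, S.Th_row, T.Th_row, Pi.single_apply, Prod.ext_iff]
    split_ifs <;> simp_all

end LimitSystem

theorem exists_round_tendsto (p : Ultrafilter ℕ) (f : ℕ → ℝ) : ∃ (φ : ℕ → ℤ) (ψ : ℝ),
    (∀ n, |f n - φ n - ψ| ≤ 1 / 2) ∧ Tendsto (fun n => f n - φ n) p (𝓝 ψ) := by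
  obtain ⟨ψ, -, hψ⟩ := exists_tendsto_of_abs_le (u := p) (f := fun n => Int.fract (f n)) (C := 1)
    (Eventually.of_forall fun n => by
      rw [abs_of_nonneg (Int.fract_nonneg _)]; exact (Int.fract_lt_one _).le)
  refine ⟨fun n => round (f n - ψ), ψ, fun n => ?_, hψ.congr' ?_⟩
  · rw [sub_right_comm]; exact abs_sub_round _
  · filter_upwards [hψ.eventually (Metric.ball_mem_nhds ψ (ε := 1 / 2) (by norm_num))] with n hn
    rw [Real.dist_eq, abs_lt] at hn
    have h : f n - ψ = ⌊f n⌋ + (Int.fract (f n) - ψ) := by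
      rw [← Int.self_sub_floor]; ring
    rw [h, round_intCast_add, round_eq_zero_iff.2 ⟨by linarith [hn.1], hn.2⟩, add_zero,
      Int.self_sub_floor]

theorem MulIdem.exists_limit {p : Ultrafilter ℕ} (hp : MulIdem p) {g : ℕ → ℝ} {ψ C : ℝ}
    (hg : ∀ n, |g n - ψ| ≤ C) (hψ : Tendsto g p (𝓝 ψ)) : ∃ gl : ℕ → ℝ,
      (∀ t, Tendsto (fun N => g (t * N)) p (𝓝 (gl t))) ∧ (∀ t, |gl t - ψ| ≤ C) ∧ gl 1 = ψ ∧
      ∀ t, Tendsto (fun N => gl (t * N)) p (𝓝 (gl t)) := by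
  have h (t : ℕ) : ∃ x, |x - ψ| ≤ C ∧ Tendsto (fun N => g (t * N)) p (𝓝 x) := by
    obtain ⟨x, hx, h⟩ := exists_tendsto_of_abs_le (u := p) (f := fun N => g (t * N) - ψ) (C := C)
      (Eventually.of_forall fun N => hg _)
    exact ⟨x + ψ, by simpa using hx, by simpa using h.add_const ψ⟩
  choose gl h1 h2 using h
  refine ⟨gl, h2, h1, tendsto_nhds_unique (h2 1) (by simpa using hψ), fun t => ?_⟩
  refine hp.tendsto_of_iterate (h2 t) (Eventually.of_forall fun a => ?_)
  simpa only [mul_assoc] using h2 (t * a)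

/-- If `u` is the nearest-integer-type error of `e` to a real combination of polynomials, then `e`
is a polynomial and `u` is continuous along `r`. -/
theorem IPPoly.of_abs_lt {r : Ultrafilter ℕ} (hr : AddIdem r) {ι : Type} [Fintype ι] (ψ : ι → ℝ)
    {f : ι → ℕ → ℤ} (hf : ∀ c, ∃ k, IPPoly r k (f c)) {e : ℕ → ℤ} {u : ℕ → ℝ}
    (he : ∀ s, (e s : ℝ) = ∑ c, ψ c * f c s - u s) {C : ℝ} (hC : C < 1) (hu : ∀ s, |u s| ≤ C) :
    (∃ k, IPPoly r k e) ∧ Tendsto u r (𝓝 0) := by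
  choose k hk using hf
  have hk' : ∀ c, IPPoly r (∑ c, k c) (f c) := fun c =>
    (hk c).mono hr (Finset.single_le_sum (f := k) (fun _ _ => Nat.zero_le _) (Finset.mem_univ c))
  have ht := IPPoly.tendsto_sub_round hr ψ hk'
  have heq : ∀ᶠ s in r, e s = _root_.round (∑ c, ψ c * f c s) := by
    filter_upwards [ht.eventually (Metric.ball_mem_nhds 0 (ε := 1 - C) (by linarith))] with s hs
    rw [Real.dist_0_eq_abs, abs_lt] at hs
    have h1 := abs_le.1 (hu s)
    rw [← sub_eq_zero, ← Int.abs_lt_one_iff, ← Int.cast_lt (R := ℝ), Int.cast_abs, abs_lt]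
    push_cast
    rw [he]
    constructor <;> linarith [hs.1, hs.2, h1.1, h1.2]
  refine ⟨⟨_, (IPPoly.round hr ψ hk').congr hr heq⟩, ht.congr' ?_⟩
  filter_upwards [heq] with s hs
  rw [← hs, he]; ring

namespace LimitSystem
variable {p r : Ultrafilter ℕ} {ι : Type} [Fintype ι] [DecidableEq ι]

/-- Adjoin to a limit system integer-valued functions `φ` with `φ (t * N) = H t *ᵥ φ N + e t`. -/
def extend (hr : AddIdem r) (S : LimitSystem p r ι) (φ e : ℕ → ι → ℤ) (ψ : ι → ℝ) (u : ℕ → ι → ℝ)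
    (hφ : ∀ t, ∀ᶠ N in p, φ (t * N) = S.H t *ᵥ φ N + e t)
    (he : ∀ t, (fun b => (e t b : ℝ)) = (S.H t).map (Int.cast : ℤ → ℝ) *ᵥ ψ - u t)
    (hu : ∀ t b, Tendsto (fun N => u (t * N) b) p (𝓝 (u t b)))
    (hu1 : u 1 = ψ)
    (hadd : ∀ᶠ a in p, ∀ b, (∃ k, IPPoly r k fun s => e (a + s) b - e a b) ∧
      Tendsto (fun s => u (a + s) b) r (𝓝 (u a b)))
    (hemul : ∀ t, ∀ᶠ N in p, e (t * N) = e t + S.H t *ᵥ e N) : LimitSystem p r (ι ⊕ ι) where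
  d := Sum.elim S.d S.d
  M n := Sum.elim (S.M n) (φ n)
  H t := Matrix.fromBlocks (S.H t) 0 (Matrix.vecMulVec (e t) (Pi.single S.i₀ 1)) (S.H t)
  K t := Matrix.fromBlocks (S.K t) 0 (Matrix.vecMulVec (-u t) (Pi.single S.i₀ 1)) (S.K t)
  Th := Matrix.fromBlocks S.Th 0 (Matrix.vecMulVec (S.Th *ᵥ ψ) (Pi.single S.i₀ 1)) S.Th
  i₀ := Sum.inl S.i₀
  M_mul t := by
    filter_upwards [S.M_mul t, hφ t] with N h1 h2
    rw [Matrix.fromBlocks_mulVec, h1, h2]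
    congr 1
    · simp
    · rw [add_comm]
      congr 1
      ext b
      simp [Matrix.mulVec, Matrix.vecMulVec_apply, dotProduct, Pi.single_apply, S.M_one]
  H_eq t := by
    have h : (Matrix.diagonal fun c => (t : ℝ) ^ Sum.elim S.d S.d c) =
        Matrix.fromBlocks (Matrix.diagonal fun c => (t : ℝ) ^ S.d c) 0 0
          (Matrix.diagonal fun c => (t : ℝ) ^ S.d c) := by
      rw [Matrix.fromBlocks_diagonal]
      congr 1
      ext (c | c) <;> rfl
    have hrow : (Pi.single S.i₀ 1 : ι → ℝ) ᵥ* (Matrix.diagonal fun c => (t : ℝ) ^ S.d c) =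
        Pi.single S.i₀ 1 := by
      ext c
      rw [Matrix.vecMul_diagonal, Pi.single_apply]
      split_ifs with h
      · simp [h, S.d_zero]
      · simp
    have hrow' : (Pi.single S.i₀ 1 : ι → ℝ) ᵥ* S.Th = Pi.single S.i₀ 1 := by
      rw [Matrix.single_one_vecMul, Matrix.row, S.Th_row]
    rw [h, Matrix.fromBlocks_multiply, Matrix.fromBlocks_multiply, Matrix.fromBlocks_map]
    simp only [Matrix.mul_zero, Matrix.zero_mul, add_zero, zero_add, ← S.H_eq]
    congr 1
    · ext; simp
    · rw [Matrix.vecMulVec_mul, Matrix.vecMulVec_mul, hrow, hrow', Matrix.mul_vecMulVec,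
        Matrix.mulVec_mulVec, ← S.H_eq, ← Matrix.add_vecMulVec, neg_add_eq_sub, ← he]
      ext b c
      simp [Matrix.vecMulVec_apply, Pi.single_apply]
  H_mul t := by
    filter_upwards [S.H_mul t, hemul t] with N h1 h2
    rw [Matrix.fromBlocks_multiply, h1, h2]
    simp only [Matrix.mul_zero, Matrix.zero_mul, add_zero, zero_add]
    congr 1
    rw [Matrix.vecMulVec_mul, Matrix.mul_vecMulVec, Matrix.single_one_vecMul, Matrix.row, S.H_row,
      Matrix.add_vecMulVec]
  K_mul t := by
    rintro (b | b) (c | c)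
    · exact S.K_mul t b c
    · exact tendsto_const_nhds
    · exact ((hu t b).neg).mul_const _
    · exact S.K_mul t b c
  H_add := by
    filter_upwards [S.H_add, hadd] with a h1 h2
    rintro (b | b) (c | c)
    · exact h1 b c
    · exact ⟨0, by simpa using IPPoly.zero 0⟩
    · obtain ⟨k, hk⟩ := (h2 b).1
      refine ⟨k, (hk.const_mul ((Pi.single S.i₀ 1 : ι → ℤ) c)).congr hr
        (Eventually.of_forall fun s => ?_)⟩
      simp only [Matrix.fromBlocks_apply₂₁, Matrix.vecMulVec_apply]; ring
    · exact h1 b c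
  K_add := by
    filter_upwards [S.K_add, hadd] with a h1 h2
    rintro (b | b) (c | c)
    · exact h1 b c
    · exact tendsto_const_nhds
    · exact ((h2 b).2.neg).mul_const _
    · exact h1 b c
  dvd t := by
    rintro (b | b) (c | c)
    · exact S.dvd t b c
    · simp
    · by_cases hc : c = S.i₀
      · simp [hc, S.d_zero]
      · simp [Matrix.vecMulVec_apply, hc]
    · exact S.dvd t b c
  Th_tri := by
    rintro (b | b) (c | c) h
    · exact S.Th_tri b c h
    · rfl
    · have hc : c ≠ S.i₀ := by rintro rfl; simp [S.d_zero] at h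
      simp [Matrix.vecMulVec_apply, hc]
    · exact S.Th_tri b c h
  K_tri := by
    rintro (b | b) (c | c) h
    · exact S.K_tri b c h
    · rfl
    · have hc : c ≠ S.i₀ := by rintro rfl; simp [S.d_zero] at h
      simp [Matrix.vecMulVec_apply, hc]
    · exact S.K_tri b c h
  K_mul_Th := by
    rw [Matrix.fromBlocks_multiply, ← Matrix.fromBlocks_one]
    simp only [Matrix.mul_zero, Matrix.zero_mul, add_zero, zero_add]
    rw [Matrix.vecMulVec_mul, Matrix.mul_vecMulVec, Matrix.single_one_vecMul, Matrix.row, S.Th_row,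
      Matrix.mulVec_mulVec, S.K_mul_Th, hu1, ← Matrix.add_vecMulVec]
    simp
  d_zero := S.d_zero
  M_one := S.M_one
  H_row t := by
    ext (c | c)
    · simp [S.H_row, Pi.single_apply]
    · simp
  K_row t := by
    ext (c | c)
    · simp [S.K_row, Pi.single_apply]
    · simp
  Th_row := by
    ext (c | c)
    · simp [S.Th_row, Pi.single_apply]
    · simp

theorem exists_extend (hp : MulIdem p) (hr : AddIdem r) (S : LimitSystem p r ι) (lam : ℝ) :
    ∃ (T : LimitSystem p r (ι ⊕ ι)) (φ : ℕ → ι → ℤ) (ψ : ι → ℝ),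
      (∀ n, T.M n = Sum.elim (S.M n) (φ n)) ∧
      (∀ b, Tendsto (fun n => lam * S.M n b - φ n b) p (𝓝 (ψ b))) ∧
      ∀ b, Tendsto (fun n => lam * S.M n b - φ n b) (shiftFilter p r) (𝓝 (ψ b)) := by
  choose φ ψ hbd hlim using fun b => exists_round_tendsto p fun n => lam * S.M n b
  choose u hu hubd hu1 huu using fun b => hp.exists_limit (hbd b) (hlim b)
  have hul : ∀ b, Tendsto (u b) p (𝓝 (ψ b)) := fun b => by
    simpa [hu1] using huu b 1
  have hreal : ∀ t b, Tendsto (fun N => ((φ b (t * N) - ∑ c, S.H t b c * φ c N : ℤ) : ℝ)) p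
      (𝓝 (∑ c, S.H t b c * ψ c - u b t)) := fun t b => by
    refine ((tendsto_finsetSum Finset.univ fun c _ => (hlim c).const_mul (S.H t b c : ℝ)).sub
      (hu b t)).congr' ?_
    filter_upwards [S.M_mul t] with N hN
    rw [hN]
    simp only [Matrix.mulVec, dotProduct, mul_sub, Finset.sum_sub_distrib]
    push_cast
    rw [Finset.mul_sum]
    have : ∑ c, (S.H t b c : ℝ) * (lam * S.M N c) = ∑ c, lam * (S.H t b c * S.M N c) :=
      Finset.sum_congr rfl fun c _ => by ring
    rw [this]; ring
  choose e he hφ using fun t b => eventually_eq_of_tendsto_intCast (hreal t b)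
  have hadd : ∀ᶠ a in p, ∀ b, (∃ k, IPPoly r k fun s => e (a + s) b - e a b) ∧
      Tendsto (fun s => u b (a + s)) r (𝓝 (u b a)) := by
    have hsmall := eventually_all.2 fun b =>
      (hul b).eventually (Metric.ball_mem_nhds (ψ b) (ε := 1 / 4) (by norm_num))
    filter_upwards [S.H_add, hsmall] with a h1 h2 b
    obtain ⟨h3, h4⟩ := IPPoly.of_abs_lt hr ψ (h1 b) (e := fun s => e (a + s) b - e a b)
      (u := fun s => u b (a + s) - u b a) (C := 3 / 4) (fun s => by
        push_cast
        rw [← he, ← he]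
        simp only [mul_comm (ψ _), sub_mul, Finset.sum_sub_distrib]
        ring) (by norm_num) (fun s => by
        have h5 := abs_le.1 (hubd b (a + s))
        have h6 := h2 b
        rw [Real.dist_eq, abs_lt] at h6
        rw [abs_le]
        constructor <;> linarith [h5.1, h5.2, h6.1, h6.2])
    exact ⟨h3, by simpa using h4.add_const (u b a)⟩
  have hemul : ∀ t, ∀ᶠ N in p, e (t * N) = e t + S.H t *ᵥ e N := fun t => by
    have h (b : ι) : ∀ᶠ N in p, e (t * N) b - (e t b + ∑ c, S.H t b c * e N c) = 0 := by
      refine eventually_eq_zero_of_tendsto_intCast ?_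
      have h1 : Tendsto (fun N => u b t - u b (t * N) -
          ∑ c, (S.H t b c : ℝ) * (ψ c - u c N)) p (𝓝 (u b t - u b t -
          ∑ c, (S.H t b c : ℝ) * (ψ c - ψ c))) :=
        ((huu b t).const_sub _).sub
          (tendsto_finsetSum _ fun c _ => ((hul c).const_sub _).const_mul _)
      simp only [sub_self, mul_zero, Finset.sum_const_zero] at h1
      refine h1.congr' ?_
      filter_upwards [S.H_mul t] with N hN
      push_cast
      simp only [← he, hN, Matrix.mul_apply, mul_sub, Finset.sum_sub_distrib, Finset.mul_sum]
      push_cast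
      simp only [Finset.sum_mul]
      rw [Finset.sum_comm]
      simp only [← mul_assoc]
      ring
    filter_upwards [eventually_all.2 h] with N hN
    ext b
    exact sub_eq_zero.1 (hN b)
  refine ⟨S.extend hr (fun n b => φ b n) e ψ (fun t b => u b t) ?_ ?_ (fun t b => huu b t)
    (funext hu1) hadd hemul, fun n b => φ b n, ψ, fun n => rfl, hlim, fun b => ?_⟩
  · intro t
    filter_upwards [eventually_all.2 (hφ t)] with N hN
    ext b
    have := hN b
    simp only [Pi.add_apply, Matrix.mulVec, dotProduct]
    linarith
  · intro t
    ext b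
    rw [← he]
    simp [Matrix.mulVec, dotProduct]
  · refine (nhds_basis_opens (ψ b)).tendsto_right_iff.2 fun s hs => ?_
    rw [eventually_shiftFilter]
    filter_upwards [(hul b).eventually_mem (hs.2.mem_nhds hs.1), hadd] with a ha h1
    filter_upwards [(h1 b).2.eventually_mem (hs.2.mem_nhds ha)] with t ht
    exact (hu b (a + t)).eventually_mem (hs.2.mem_nhds ht)

end LimitSystem

/-- The functional `X ↦ ∑ A b c * X b c`. -/
def pairing {ι : Type} [Fintype ι] (A : Matrix ι ι ℝ) : Module.Dual ℝ (Matrix ι ι ℝ) where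
  toFun X := ∑ b, ∑ c, A b c * X b c
  map_add' X Y := by simp [mul_add, Finset.sum_add_distrib]
  map_smul' t X := by simp [Finset.mul_sum, mul_left_comm]

theorem pairing_apply {ι : Type} [Fintype ι] (A X : Matrix ι ι ℝ) :
    pairing A X = ∑ b, ∑ c, A b c * X b c := rfl

theorem pairing_comm {ι : Type} [Fintype ι] (A X : Matrix ι ι ℝ) :
    pairing A X = pairing X A := by
  simp only [pairing_apply, mul_comm]

theorem exists_pairing_eq {ι : Type} [Fintype ι] [DecidableEq ι]
    (L : Module.Dual ℝ (Matrix ι ι ℝ)) : ∃ A, L = pairing A := by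
  refine ⟨fun b c => L (Matrix.single b c 1), LinearMap.ext fun X => ?_⟩
  conv_lhs => rw [Matrix.matrix_eq_sum_single X]
  simp only [map_sum]
  refine Finset.sum_congr rfl fun b _ => Finset.sum_congr rfl fun c _ => ?_
  rw [show Matrix.single b c (X b c) = X b c • Matrix.single b c (1 : ℝ) by simp, map_smul,
    smul_eq_mul, mul_comm]

/-- The real solutions of a homogeneous system of linear equations with integer coefficients are
spanned by the integer solutions. -/
theorem mem_span_integer_solutions {ι : Type} [Fintype ι] (B : Set (Matrix ι ι ℤ))
    (X : Matrix ι ι ℝ) (hX : ∀ A ∈ B, pairing (A.map Int.cast) X = 0) :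
    X ∈ Submodule.span ℝ ((fun Z : Matrix ι ι ℤ => Z.map (Int.cast : ℤ → ℝ)) ''
      {Z | ∀ A ∈ B, pairing (A.map Int.cast) (Z.map Int.cast) = 0}) := by
  classical
  let β := Module.Basis.ofVectorSpace ℚ ℝ
  let s := Finset.univ.biUnion fun b : ι => Finset.univ.biUnion fun c : ι =>
    (β.repr (X b c)).support
  have hsum : X = ∑ k ∈ s, β k • (Matrix.of fun b c => ((β.repr (X b c) k : ℚ) : ℝ)) := by
    ext b c
    rw [Matrix.sum_apply]
    conv_lhs => rw [← β.linearCombination_repr (X b c), Finsupp.linearCombination_apply]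
    rw [Finsupp.sum_of_support_subset (s := s) _ (fun k hk => by
      simp only [s, Finset.mem_biUnion]; exact ⟨b, Finset.mem_univ _, c, Finset.mem_univ _, hk⟩) _
      (by simp)]
    refine Finset.sum_congr rfl fun k _ => ?_
    simp [Rat.smul_def, mul_comm]
  rw [hsum]
  refine Submodule.sum_mem _ fun k _ => Submodule.smul_mem _ _ ?_
  let q : Matrix ι ι ℚ := fun b c => β.repr (X b c) k
  have hq : ∀ A ∈ B, ∑ b, ∑ c, (A b c : ℚ) * q b c = 0 := fun A hA => by
    have h := congrArg (fun x => β.repr x k) (hX A hA)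
    simp only [pairing_apply, map_sum, Finsupp.coe_finsetSum, Finset.sum_apply, map_zero,
      Finsupp.coe_zero, Pi.zero_apply] at h
    rw [← h]
    refine Finset.sum_congr rfl fun b _ => Finset.sum_congr rfl fun c _ => ?_
    have : (A.map Int.cast : Matrix ι ι ℝ) b c * X b c = (A b c : ℚ) • X b c := by
      simp [Rat.smul_def]
    rw [this, map_smul]; rfl
  let D : ℕ := ∏ b, ∏ c, (q b c).den
  have hD : (D : ℝ) ≠ 0 := by
    simp [D, Finset.prod_eq_zero_iff]
  have hdvd : ∀ b c, (q b c).den ∣ D := fun b c =>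
    (Finset.dvd_prod_of_mem (fun c => (q b c).den) (Finset.mem_univ c)).trans
      (Finset.dvd_prod_of_mem (fun b => ∏ c, (q b c).den) (Finset.mem_univ b))
  have hz_int : ∀ b c, ∃ z : ℤ, (z : ℚ) = D * q b c := fun b c => by
    obtain ⟨m, hm⟩ := hdvd b c
    refine ⟨m * (q b c).num, ?_⟩
    rw [hm]
    push_cast
    rw [mul_right_comm, Rat.den_mul_eq_num, mul_comm]
  choose z hz using hz_int
  have hzr : ∀ b c, (z b c : ℝ) = D * (q b c : ℝ) := fun b c => by exact_mod_cast hz b c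
  have : (Matrix.of fun b c => ((β.repr (X b c) k : ℚ) : ℝ)) =
      (D : ℝ)⁻¹ • (Matrix.of z).map (Int.cast : ℤ → ℝ) := by
    ext b c
    simp only [Matrix.of_apply, Matrix.smul_apply, Matrix.map_apply, hzr, smul_eq_mul]
    rw [inv_mul_cancel_left₀ hD]
  rw [this]
  refine Submodule.smul_mem _ _ (Submodule.subset_span ⟨Matrix.of z, fun A hA => ?_, rfl⟩)
  have h2 : (∑ b, ∑ c, (A b c : ℚ) * (z b c : ℚ)) = 0 := by
    simp only [hz, mul_left_comm _ (D : ℚ), ← Finset.mul_sum, hq A hA, mul_zero]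
  rw [pairing_apply]
  simp only [Matrix.map_apply, Matrix.of_apply]
  exact_mod_cast h2

/-- Leading term of a polynomial expression with convergent coefficients. -/
theorem tendsto_leading {α V : Type*} [AddCommGroup V] [Module ℝ V] [TopologicalSpace V]
    [ContinuousAdd V] [ContinuousSMul ℝ V] {l : Filter α} {x : α → ℝ} (hx : Tendsto x l atTop)
    {A : α → ℕ → V} {L : ℕ → V} (hA : ∀ e, Tendsto (fun i => A i e) l (𝓝 (L e))) {d B : ℕ}
    (hd : d < B) (hz : ∀ e, d < e → ∀ᶠ i in l, A i e = 0) :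
    Tendsto (fun i => (x i ^ d)⁻¹ • ∑ e ∈ Finset.range B, x i ^ e • A i e) l (𝓝 (L d)) := by
  have h : ∀ e ∈ Finset.range B, Tendsto (fun i => (x i ^ d)⁻¹ • x i ^ e • A i e) l
      (𝓝 (if e = d then L d else 0)) := fun e _ => by
    simp only [smul_smul]
    rcases lt_trichotomy e d with he | rfl | he
    · rw [if_neg he.ne]
      have := ((tendsto_pow_div_pow_atTop_zero (𝕜 := ℝ) he).comp hx).smul (hA e)
      simpa [div_eq_inv_mul] using this
    · rw [if_pos rfl]
      refine (hA e).congr' ?_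
      filter_upwards [hx.eventually_gt_atTop 0] with i hi
      rw [inv_mul_cancel₀ (pow_pos hi _).ne', one_smul]
    · rw [if_neg he.ne']
      refine tendsto_const_nhds.congr' ?_
      filter_upwards [hz e he] with i hi
      rw [hi, smul_zero]
  have := tendsto_finsetSum _ h
  simpa [Finset.smul_sum, Finset.sum_ite_eq', hd] using this

theorem Filter.Tendsto.matrix_mul_const {α ι : Type*} [Fintype ι] {l : Filter α}
    {A : α → Matrix ι ι ℝ} {L : Matrix ι ι ℝ} (h : Tendsto A l (𝓝 L)) (C : Matrix ι ι ℝ) :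
    Tendsto (fun i => A i * C) l (𝓝 (L * C)) :=
  ((continuous_id.matrix_mul continuous_const).tendsto L).comp h

namespace LimitSystem
variable {p r : Ultrafilter ℕ} {ι : Type} [Fintype ι] [DecidableEq ι] (S : LimitSystem p r ι)

/-- The transition matrix with real entries. -/
def Hr (t : ℕ) : Matrix ι ι ℝ := (S.H t).map Int.cast

/-- The projection onto the rows of degree `d`. -/
def proj (d : ℕ) : Matrix ι ι ℝ := Matrix.diagonal fun c => if S.d c = d then 1 else 0

/-- The part of the transition matrix that is homogeneous of degree `d`, divided by `t ^ d`. -/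
def part (t d : ℕ) : Matrix ι ι ℝ := S.K t * S.proj d * S.Th

/-- A strict upper bound for the degrees. -/
def bound : ℕ := Finset.univ.sup S.d + 1

theorem d_lt_bound (c : ι) : S.d c < S.bound :=
  Nat.lt_succ_of_le (Finset.le_sup (f := S.d) (Finset.mem_univ c))

theorem Hr_eq_sum (t : ℕ) :
    S.Hr t = ∑ d ∈ Finset.range S.bound, (t : ℝ) ^ d • S.part t d := by
  have : Matrix.diagonal (fun c => (t : ℝ) ^ S.d c) =
      ∑ d ∈ Finset.range S.bound, (t : ℝ) ^ d • S.proj d := by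
    ext b c
    rw [Matrix.sum_apply]
    by_cases h : b = c
    · subst h
      simp [proj, S.d_lt_bound]
    · simp [proj, h]
  simp only [Hr, part, S.H_eq, this, Finset.mul_sum, Finset.sum_mul, Matrix.mul_smul,
    Matrix.smul_mul]

theorem proj_eq_zero {d : ℕ} (hd : S.bound ≤ d) : S.proj d = 0 := by
  ext b c
  have : S.d b ≠ d := ((S.d_lt_bound b).trans_le hd).ne
  simp [proj, Matrix.diagonal_apply, this]

theorem part_eq_zero {d : ℕ} (hd : S.bound ≤ d) (t : ℕ) : S.part t d = 0 := by
  rw [part, S.proj_eq_zero hd, Matrix.mul_zero, Matrix.zero_mul]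

theorem part_mul_part (t d e : ℕ) :
    S.part t d * S.part 1 e = if d = e then S.part t d else 0 := by
  have h : S.proj d * S.proj e = if d = e then S.proj d else 0 := by
    simp only [proj, Matrix.diagonal_mul_diagonal]
    split_ifs with h1
    · subst h1
      congr 1; ext c; split_ifs <;> simp
    · rw [← Matrix.diagonal_zero]
      congr 1; ext c
      split_ifs with h2 h3
      · exact absurd (h2.symm.trans h3) h1
      all_goals simp
  have hT : S.Th * S.K 1 = 1 := mul_eq_one_comm.1 S.K_mul_Th
  calc S.part t d * S.part 1 e = S.K t * (S.proj d * (S.Th * S.K 1) * S.proj e) * S.Th := by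
        simp only [part, Matrix.mul_assoc]
    _ = _ := by
        rw [hT, Matrix.mul_one, h]
        split_ifs <;> simp [part]

theorem Hr_mul_part (t d : ℕ) : S.Hr t * S.part 1 d = (t : ℝ) ^ d • S.part t d := by
  rw [Hr_eq_sum, Finset.sum_mul]
  simp only [Matrix.smul_mul, part_mul_part, smul_ite, smul_zero, Finset.sum_ite_eq',
    Finset.mem_range]
  split_ifs with h
  · rfl
  · rw [S.part_eq_zero (not_lt.1 h), smul_zero]

theorem Hr_mul_part_mul (t d : ℕ) (X : Matrix ι ι ℝ) :
    S.Hr t * (S.part 1 d * X) = (t : ℝ) ^ d • (S.part t d * X) := by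
  rw [← Matrix.mul_assoc, Hr_mul_part, Matrix.smul_mul]

theorem Hr_mul (t : ℕ) : ∀ᶠ N in p, S.Hr (t * N) = S.Hr t * S.Hr N := by
  filter_upwards [S.H_mul t] with N hN
  ext b c
  simp [Hr, hN, Matrix.mul_apply]

theorem tendsto_part (t d : ℕ) : Tendsto (fun N => S.part (t * N) d) p (𝓝 (S.part t d)) :=
  have h : Tendsto (fun N => S.K (t * N)) p (𝓝 (S.K t)) :=
    tendsto_pi_nhds.2 fun b => tendsto_pi_nhds.2 fun c => S.K_mul t b c
  (h.matrix_mul_const (S.proj d)).matrix_mul_const S.Th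

theorem tendsto_part_one (d : ℕ) : Tendsto (fun N => S.part N d) p (𝓝 (S.part 1 d)) := by
  simpa using S.tendsto_part 1 d

theorem eventually_tendsto_part : ∀ᶠ a in p, ∀ d,
    Tendsto (fun s => S.part (a + s) d) r (𝓝 (S.part a d)) := by
  filter_upwards [S.K_add] with a ha d
  have h : Tendsto (fun s => S.K (a + s)) r (𝓝 (S.K a)) :=
    tendsto_pi_nhds.2 fun b => tendsto_pi_nhds.2 fun c => ha b c
  exact (h.matrix_mul_const (S.proj d)).matrix_mul_const S.Th

/-- The linear relations satisfied by the transition matrices along `p`. -/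
def rel : Submodule ℝ (Module.Dual ℝ (Matrix ι ι ℝ)) where
  carrier := {L | ∀ᶠ N in p, L (S.Hr N) = 0}
  add_mem' h1 h2 := by
    filter_upwards [h1, h2] with N h3 h4
    simp [h3, h4]
  zero_mem' := by simp
  smul_mem' t L h := by
    filter_upwards [h] with N h
    simp [h]

theorem mem_rel {L : Module.Dual ℝ (Matrix ι ι ℝ)} :
    L ∈ S.rel ↔ ∀ᶠ N in p, L (S.Hr N) = 0 := Iff.rfl

/-- The space of matrices cut out by the linear relations satisfied by the transition matrices. -/
def hull : Submodule ℝ (Matrix ι ι ℝ) := S.rel.dualCoannihilator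

theorem mem_hull {X : Matrix ι ι ℝ} : X ∈ S.hull ↔ ∀ L ∈ S.rel, L X = 0 :=
  Submodule.mem_dualCoannihilator _

theorem isClosed_hull : IsClosed (S.hull : Set (Matrix ι ι ℝ)) :=
  Submodule.closed_of_finiteDimensional _

theorem eventually_mem_hull : ∀ᶠ N in p, S.Hr N ∈ S.hull := by
  obtain ⟨F, hF⟩ := IsNoetherian.noetherian S.rel
  have : ∀ᶠ N in p, ∀ L ∈ F, L (S.Hr N) = 0 := (eventually_all_finset F).2 fun L hL =>
    S.mem_rel.1 (hF ▸ Submodule.subset_span hL)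
  filter_upwards [this] with N hN
  refine S.mem_hull.2 fun L hL => ?_
  rw [← hF] at hL
  induction hL using Submodule.span_induction with
  | mem L h => exact hN L h
  | zero => rfl
  | add L L' _ _ h h' => simp [h, h']
  | smul c L _ h => simp [h]

theorem eventually_mul_mem_hull (hp : MulIdem p) :
    ∀ᶠ t in p, ∀ X ∈ S.hull, S.Hr t * X ∈ S.hull := by
  obtain ⟨F, hF⟩ := IsNoetherian.noetherian S.rel
  have : ∀ᶠ t in p, ∀ L ∈ F, L ∘ₗ LinearMap.mulLeft ℝ (S.Hr t) ∈ S.rel :=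
    (eventually_all_finset F).2 fun L hL => by
      have h1 : ∀ᶠ N in p, L (S.Hr N) = 0 := S.mem_rel.1 (hF ▸ Submodule.subset_span hL)
      filter_upwards [(hp _).1 h1] with t ht
      filter_upwards [ht, S.Hr_mul t] with N h2 h3
      rwa [h3] at h2
  filter_upwards [this] with t ht X hX
  refine S.mem_hull.2 fun L hL => ?_
  rw [← hF] at hL
  induction hL using Submodule.span_induction with
  | mem L h => exact S.mem_hull.1 hX _ (ht L h)
  | zero => rfl
  | add L L' _ _ h h' => simp [h, h']
  | smul c L _ h => simp [h]

theorem tendsto_natCast (hinf : Tendsto (fun n : ℕ => n) p atTop) {t : ℕ} (ht : 0 < t) :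
    Tendsto (fun N : ℕ => ((t * N : ℕ) : ℝ)) p atTop :=
  tendsto_natCast_atTop_atTop.comp
    (tendsto_atTop_mono (fun N => Nat.le_mul_of_pos_left N ht) hinf)

theorem part_one_mul_mem_hull (hp : MulIdem p) (hinf : Tendsto (fun n : ℕ => n) p atTop)
    {X : Matrix ι ι ℝ} (hX : X ∈ S.hull) (d : ℕ) : S.part 1 d * X ∈ S.hull := by
  induction hm : S.bound - d using Nat.strong_induction_on generalizing d with
  | _ m ih =>
  rcases le_or_gt S.bound d with hd | hd
  · rw [S.part_eq_zero hd, Matrix.zero_mul]; exact zero_mem _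
  let Y := X - ∑ e ∈ Finset.range S.bound with d < e, S.part 1 e * X
  have hY : Y ∈ S.hull := sub_mem hX (sum_mem fun e he => ih _ (by
    rw [Finset.mem_filter, Finset.mem_range] at he; omega) e rfl)
  have hN : ∀ t : ℕ, S.Hr t * Y = ∑ e ∈ Finset.range S.bound,
      ((1 * t : ℕ) : ℝ) ^ e • if d < e then 0 else S.part t e * X := fun t => by
    simp only [Y, Matrix.mul_sub, Finset.mul_sum, S.Hr_mul_part_mul]
    rw [Finset.sum_filter, S.Hr_eq_sum, Finset.sum_mul, ← Finset.sum_sub_distrib]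
    refine Finset.sum_congr rfl fun e _ => ?_
    split_ifs <;> simp
  have hlim := tendsto_leading (tendsto_natCast hinf one_pos)
    (A := fun N e => if d < e then 0 else S.part N e * X)
    (L := fun e => if d < e then 0 else S.part 1 e * X) (fun e => by
      split_ifs
      · exact tendsto_const_nhds
      · exact (S.tendsto_part_one e).matrix_mul_const _) hd
    (fun e he => Eventually.of_forall fun N => if_pos he)
  simp only [lt_irrefl, if_false] at hlim
  refine S.isClosed_hull.mem_of_tendsto hlim ?_
  filter_upwards [S.eventually_mul_mem_hull hp] with N h1
  rw [← hN]
  exact Submodule.smul_mem _ _ (h1 Y hY)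

theorem part_mul_mem_hull (hp : MulIdem p) (hinf : Tendsto (fun n : ℕ => n) p atTop) {a : ℕ}
    (ha : 0 < a) (h : ∀ X ∈ S.hull, S.Hr a * X ∈ S.hull) {X : Matrix ι ι ℝ} (hX : X ∈ S.hull)
    (d : ℕ) : S.part a d * X ∈ S.hull := by
  have h1 := h _ (S.part_one_mul_mem_hull hp hinf hX d)
  rw [S.Hr_mul_part_mul] at h1
  have h2 := Submodule.smul_mem _ ((a : ℝ) ^ d)⁻¹ h1
  rwa [inv_smul_smul₀ (by positivity)] at h2

end LimitSystem

theorem pairing_single {ι : Type} [Fintype ι] [DecidableEq ι] (b c : ι) (X : Matrix ι ι ℝ) :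
    pairing ((Matrix.single b c (1 : ℤ)).map Int.cast) X = X b c := by
  rw [pairing_apply, Finset.sum_eq_single b, Finset.sum_eq_single c]
  · simp
  · intro c' _ hc; simp [hc.symm]
  · simp
  · intro b' _ hb; simp [hb.symm]
  · simp

/-- An integer multiple of a positive real `x` that is smaller than `x` vanishes. -/
theorem eq_zero_of_dvd_of_abs_lt {m x : ℤ} {y : ℝ} (hx : 0 < x) (h : x ∣ m)
    (hm : (m : ℝ) = x * y) (hy : |y| < 1) : y = 0 := by
  obtain ⟨q, rfl⟩ := h
  have hx' : (x : ℝ) ≠ 0 := by exact_mod_cast hx.ne'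
  have hq : (q : ℝ) = y := by
    push_cast at hm
    exact mul_left_cancel₀ hx' hm
  rw [← hq] at hy ⊢
  have : |q| < 1 := by exact_mod_cast hy
  rw [Int.abs_lt_one_iff.1 this, Int.cast_zero]

namespace LimitSystem
variable {p r : Ultrafilter ℕ} {ι : Type} [Fintype ι] [DecidableEq ι] (S : LimitSystem p r ι)

theorem exists_integer_relations : ∃ F : Finset (Matrix ι ι ℝ),
    (∀ A ∈ F, pairing A ∈ S.rel ∧ ∃ Z : Matrix ι ι ℤ, Z.map Int.cast = A) ∧
    ∀ X, (∀ A ∈ F, pairing A X = 0) → X ∈ S.hull := by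
  let B : Set (Matrix ι ι ℤ) := {Z | ∃ N, S.Hr N ∈ S.hull ∧ Z = S.H N}
  obtain ⟨F, hF, hspan⟩ := Submodule.fg_span_iff_fg_span_finset_subset _ |>.1
    (IsNoetherian.noetherian (Submodule.span ℝ
      ((fun Z : Matrix ι ι ℤ => Z.map (Int.cast : ℤ → ℝ)) '' {Z | ∀ A ∈ B, pairing (A.map Int.cast) (Z.map Int.cast) = 0})))
  refine ⟨F, fun A hA => ?_, fun X hX => S.mem_hull.2 fun L hL => ?_⟩
  · obtain ⟨Z, hZ, rfl⟩ := hF hA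
    refine ⟨?_, Z, rfl⟩
    rw [mem_rel]
    filter_upwards [S.eventually_mem_hull] with N hN
    rw [pairing_comm]
    exact hZ _ ⟨N, hN, rfl⟩
  · obtain ⟨A, rfl⟩ := exists_pairing_eq L
    have hA : A ∈ Submodule.span ℝ (F : Set (Matrix ι ι ℝ)) := by
      rw [← hspan]
      refine mem_span_integer_solutions B A ?_
      rintro _ ⟨N, hN, rfl⟩
      rw [pairing_comm]
      exact S.mem_hull.1 hN _ hL
    rw [pairing_comm]
    exact (Submodule.span_le (p := LinearMap.ker (pairing X))).2 (fun A' hA' => by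
      rw [SetLike.mem_coe, LinearMap.mem_ker, pairing_comm, hX A' hA']) hA

theorem exists_integer_generators (d : ℕ) : ∃ F : Finset (Matrix ι ι ℝ),
    (∀ X ∈ F, X ∈ S.hull ∧ (∀ b c, S.d b < d → X b c = 0) ∧
      ∃ Z : Matrix ι ι ℤ, Z.map Int.cast = X) ∧
    ∀ X ∈ S.hull, (∀ b c, S.d b < d → X b c = 0) →
      X ∈ Submodule.span ℝ (F : Set (Matrix ι ι ℝ)) := by
  obtain ⟨G, hG, hGh⟩ := S.exists_integer_relations
  let B : Set (Matrix ι ι ℤ) := {Z | pairing (Z.map Int.cast) ∈ S.rel} ∪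
    {Z | ∃ b c, S.d b < d ∧ Z = Matrix.single b c 1}
  obtain ⟨F, hF, hspan⟩ := Submodule.fg_span_iff_fg_span_finset_subset _ |>.1
    (IsNoetherian.noetherian (Submodule.span ℝ
      ((fun Z : Matrix ι ι ℤ => Z.map (Int.cast : ℤ → ℝ)) '' {Z | ∀ A ∈ B, pairing (A.map Int.cast) (Z.map Int.cast) = 0})))
  refine ⟨F, fun X hX => ?_, fun X hX h0 => hspan ▸ mem_span_integer_solutions B X ?_⟩
  · obtain ⟨Z, hZ, rfl⟩ := hF hX
    refine ⟨hGh _ fun A hA => ?_, fun b c hb => ?_, Z, rfl⟩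
    · obtain ⟨hA, W, rfl⟩ := hG A hA
      exact hZ W (Or.inl hA)
    · exact (pairing_single b c _).symm.trans (hZ _ (Or.inr ⟨b, c, hb, rfl⟩))
  · rintro A (hA | ⟨b, c, hb, rfl⟩)
    · exact S.mem_hull.1 hX _ hA
    · rw [pairing_single, h0 b c hb]

theorem part_mul_eq_zero {X : Matrix ι ι ℝ} {d e t : ℕ} (hX : ∀ b c, S.d b < d → X b c = 0)
    (he : e < d) : S.part t e * X = 0 := by
  have h : S.proj e * (S.Th * X) = 0 := by
    ext b c
    rw [proj, Matrix.diagonal_mul, Matrix.mul_apply, Matrix.zero_apply]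
    split_ifs with hb
    · rw [one_mul]
      refine Finset.sum_eq_zero fun b' _ => ?_
      rcases lt_or_ge (S.d b') d with h1 | h1
      · rw [hX _ _ h1, mul_zero]
      · rw [S.Th_tri b b' (by omega), zero_mul]
    · rw [zero_mul]
  rw [part, Matrix.mul_assoc, Matrix.mul_assoc, h, Matrix.mul_zero]

theorem part_one_mul_apply_eq_zero (X : Matrix ι ι ℝ) (d : ℕ) (b c : ι) (hb : S.d b < d) :
    (S.part 1 d * X) b c = 0 := by
  rw [part, Matrix.mul_assoc, Matrix.mul_assoc, Matrix.mul_apply]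
  refine Finset.sum_eq_zero fun b' _ => ?_
  rw [proj, Matrix.diagonal_mul]
  split_ifs with h
  · rw [S.K_tri b b' (by omega), zero_mul]
  · rw [zero_mul, mul_zero]

theorem dvd_pairing_Hr_mul {d : ℕ} (t : ℕ) {A X : Matrix ι ι ℤ}
    (hX : ∀ b c, S.d b < d → X b c = 0) :
    ∃ m : ℤ, (t : ℤ) ^ d ∣ m ∧
      (m : ℝ) = pairing (A.map Int.cast) (S.Hr t * X.map Int.cast) := by
  refine ⟨∑ b, ∑ c, A b c * (S.H t * X) b c, ?_, ?_⟩
  · refine Finset.dvd_sum fun b _ => Finset.dvd_sum fun c _ => Dvd.dvd.mul_left ?_ _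
    rw [Matrix.mul_apply]
    refine Finset.dvd_sum fun b' _ => ?_
    rcases lt_or_ge (S.d b') d with h1 | h1
    · rw [hX _ _ h1, mul_zero]; exact dvd_zero _
    · exact ((pow_dvd_pow _ h1).trans (S.dvd t b b')).mul_right _
  · simp [pairing_apply, Hr, Matrix.mul_apply]

theorem eventually_add_mul_mem_hull (hp : MulIdem p) (hinf : Tendsto (fun n : ℕ => n) p atTop) :
    ∀ᶠ a in p, ∀ᶠ s in r, ∀ X ∈ S.hull, S.Hr (a + s) * X ∈ S.hull := by
  obtain ⟨G, hG, hGh⟩ := S.exists_integer_relations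
  choose F hF hFspan using S.exists_integer_generators
  filter_upwards [S.eventually_mul_mem_hull hp, S.eventually_tendsto_part,
    hinf.eventually_gt_atTop 0] with a ha hat ha0
  have hsmall : ∀ᶠ s in r, ∀ A ∈ G, ∀ d ∈ Finset.range S.bound, ∀ X ∈ F d,
      |pairing A (S.part (a + s) d * X)| < 1 := by
    refine (eventually_all_finset _).2 fun A hA => (eventually_all_finset _).2 fun d _ =>
      (eventually_all_finset _).2 fun X hX => ?_
    have h0 : pairing A (S.part a d * X) = 0 :=
      S.mem_hull.1 (S.part_mul_mem_hull hp hinf ha0 ha (hF d X hX).1 d) _ (hG A hA).1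
    have h1 := (((pairing A).continuous_of_finiteDimensional.tendsto _).comp
      ((hat d).matrix_mul_const X)).abs
    rw [h0, abs_zero] at h1
    exact h1.eventually_lt_const one_pos
  filter_upwards [hsmall] with s hs
  have key : ∀ j d, S.bound - d = j → ∀ X ∈ S.hull, ∀ A ∈ G,
      pairing A (S.part (a + s) d * X) = 0 := by
    intro j
    induction j using Nat.strong_induction_on with
    | _ j ih =>
    rintro d rfl X hX A hA
    rcases le_or_gt S.bound d with hd | hd
    · rw [S.part_eq_zero hd, Matrix.zero_mul, map_zero]
    have hgen : ∀ Y ∈ F d, pairing A (S.part (a + s) d * Y) = 0 := by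
      intro Y hY
      obtain ⟨hYh, hY0, Z, hZ⟩ := hF d Y hY
      obtain ⟨_, W, hW⟩ := hG A hA
      obtain ⟨m, hm, hm'⟩ := S.dvd_pairing_Hr_mul (d := d) (a + s) (A := W) (X := Z)
        fun b c hb => by
          have := hY0 b c hb
          rw [← hZ, Matrix.map_apply] at this
          exact_mod_cast this
      rw [hW, hZ, Hr_eq_sum, Finset.sum_mul, map_sum, Finset.sum_eq_single d] at hm'
      · rw [Matrix.smul_mul, map_smul, smul_eq_mul] at hm'
        refine eq_zero_of_dvd_of_abs_lt (pow_pos (by positivity) d) hm ?_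
          (hs A hA d (Finset.mem_range.2 hd) Y hY)
        rw [hm']
        push_cast
        rfl
      · intro e _ hed
        rw [Matrix.smul_mul, map_smul]
        rcases lt_or_gt_of_ne hed with h1 | h1
        · rw [S.part_mul_eq_zero hY0 h1, map_zero, smul_zero]
        · rw [ih _ (by omega) e rfl Y hYh A hA, smul_zero]
      · intro h
        exact absurd (Finset.mem_range.2 hd) h
    have h1 : S.part 1 d * X ∈ Submodule.span ℝ (F d : Set (Matrix ι ι ℝ)) :=
      hFspan d _ (S.part_one_mul_mem_hull hp hinf hX d) (S.part_one_mul_apply_eq_zero X d)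
    have h2 := (Submodule.span_le
      (p := LinearMap.ker (pairing A ∘ₗ LinearMap.mulLeft ℝ (S.part (a + s) d)))).2
      (fun Y hY => by simpa using hgen Y hY) h1
    rw [LinearMap.mem_ker, LinearMap.comp_apply, LinearMap.mulLeft_apply, ← Matrix.mul_assoc,
      part_mul_part, if_pos rfl] at h2
    exact h2
  intro X hX
  refine hGh _ fun A hA => ?_
  rw [Hr_eq_sum, Finset.sum_mul, map_sum]
  refine Finset.sum_eq_zero fun d _ => ?_
  rw [Matrix.smul_mul, map_smul, key _ d rfl X hX A hA, smul_zero]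

theorem eventually_shiftFilter_mem_hull (hp : MulIdem p)
    (hinf : Tendsto (fun n : ℕ => n) p atTop) : ∀ᶠ n in shiftFilter p r, S.Hr n ∈ S.hull := by
  rw [eventually_shiftFilter]
  filter_upwards [S.eventually_add_mul_mem_hull hp hinf] with a ha
  filter_upwards [ha] with s hs
  filter_upwards [S.Hr_mul (a + s), S.eventually_mem_hull] with N h1 h2
  rw [h1]
  exact hs _ h2

end LimitSystem

theorem MulIdem.eventually_shiftFilter {p r : Ultrafilter ℕ} (hp : MulIdem p) {Q : ℕ → Prop}
    (h : ∀ᶠ t in shiftFilter p r, ∀ᶠ N in p, Q (t * N)) : ∀ᶠ n in shiftFilter p r, Q n := by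
  rw [_root_.eventually_shiftFilter] at h ⊢
  filter_upwards [h] with a ha
  filter_upwards [ha] with s hs
  exact (hp fun n => Q ((a + s) * n)).2 (by simpa only [mul_assoc] using hs)

/-- The directions of a nonvanishing family of functionals on a finite-dimensional space
accumulate. -/
theorem exists_dual_limit {p : Ultrafilter ℕ} {V : Type} [AddCommGroup V] [Module ℝ V] [FiniteDimensional ℝ V]
    (L : ℕ → Module.Dual ℝ V) (hL : ∀ᶠ N in p, L N ≠ 0) :
    ∃ (x : ℕ → ℝ) (L' : Module.Dual ℝ V), L' ≠ 0 ∧ (∀ᶠ N in p, 0 < x N) ∧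
      ∀ X, Tendsto (fun N => x N * L N X) p (𝓝 (L' X)) := by
  let β := Module.finBasis ℝ V
  let v : ℕ → (Fin (Module.finrank ℝ V) → ℝ) := fun N i => L N (β i)
  have hv : ∀ᶠ N in p, v N ≠ 0 := by
    filter_upwards [hL] with N hN h
    exact hN (β.ext fun i => by simpa using congrFun h i)
  have hs : ∀ᶠ N in p, ‖v N‖⁻¹ • v N ∈ Metric.sphere (0 : Fin (Module.finrank ℝ V) → ℝ) 1 := by
    filter_upwards [hv] with N hN
    simp [norm_smul, hN]
  obtain ⟨u, hu, hlim⟩ := (isCompact_sphere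
    (0 : Fin (Module.finrank ℝ V) → ℝ) 1).ultrafilter_le_nhds (p.map fun N => ‖v N‖⁻¹ • v N) (le_principal_iff.2 hs)
  have hlim' : Tendsto (fun N => ‖v N‖⁻¹ • v N) p (𝓝 u) := hlim
  refine ⟨fun N => ‖v N‖⁻¹, β.constr ℝ u, fun h => ?_, ?_, fun X => ?_⟩
  · have : u = 0 := funext fun i => by
      rw [← β.constr_basis ℝ u i, h]; rfl
    simp [this] at hu
  · filter_upwards [hv] with N hN
    positivity
  · have h1 : ∀ N, ‖v N‖⁻¹ * L N X = ∑ i, β.repr X i * (‖v N‖⁻¹ • v N) i := fun N => by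
      conv_lhs => rw [← β.sum_repr X]
      simp only [map_sum, map_smul, smul_eq_mul, Finset.mul_sum, Pi.smul_apply, v]
      exact Finset.sum_congr rfl fun i _ => by ring
    have h2 : β.constr ℝ u X = ∑ i, β.repr X i * u i := by
      simp [Module.Basis.constr_apply_fintype]
    simp only [h1]
    rw [h2]
    exact tendsto_finsetSum _ fun i _ => (tendsto_pi_nhds.1 hlim' i).const_mul _

namespace LimitSystem
variable {p r : Ultrafilter ℕ} {ι : Type} [Fintype ι] [DecidableEq ι] (S : LimitSystem p r ι)

theorem eventually_Hr_pos (hinf : Tendsto (fun n : ℕ => n) p atTop)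
    {L : Module.Dual ℝ (Matrix ι ι ℝ)} {D t : ℕ} (ht : 0 < t) (hD : 0 < L (S.part t D))
    (hz : ∀ d, D < d → ∀ᶠ N in p, L (S.part N d) = 0)
    (hh : ∀ᶠ N in p, S.Hr (t * N) ∈ S.hull) : ∀ᶠ N in p, 0 < L (S.Hr (t * N)) := by
  have hDb : D < S.bound := by
    by_contra! h
    rw [S.part_eq_zero h, map_zero] at hD
    exact hD.false
  have hz' : ∀ d, D < d → ∀ᶠ N in p, L (S.part (t * N) d) = 0 := fun d hd => by
    have hrel : L ∘ₗ LinearMap.mulRight ℝ (S.part 1 d) ∈ S.rel := by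
      rw [mem_rel]
      filter_upwards [hz d hd] with N hN
      rw [LinearMap.comp_apply, LinearMap.mulRight_apply, Hr_mul_part, map_smul, hN, smul_zero]
    filter_upwards [hh, hinf.eventually_gt_atTop 0] with N hN hN0
    have h := S.mem_hull.1 hN _ hrel
    rw [LinearMap.comp_apply, LinearMap.mulRight_apply, Hr_mul_part, map_smul, smul_eq_mul] at h
    exact (mul_eq_zero.1 h).resolve_left (by positivity)
  have h := tendsto_leading (tendsto_natCast hinf ht)
    (fun e => (L.continuous_of_finiteDimensional.tendsto _).comp (S.tendsto_part t e)) hDb hz'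
  filter_upwards [h.eventually_const_lt hD, hinf.eventually_gt_atTop 0] with N hN hN0
  have hpos : (0 : ℝ) < ((t * N : ℕ) : ℝ) ^ D := by positivity
  rw [smul_eq_mul] at hN
  rw [Hr_eq_sum, map_sum]
  simp only [map_smul]
  exact (pos_iff_pos_of_mul_pos hN).1 (inv_pos.2 hpos)

theorem eventually_Hr_pos_of_part_pos (hp : MulIdem p) (hinf : Tendsto (fun n : ℕ => n) p atTop)
    {L : Module.Dual ℝ (Matrix ι ι ℝ)} {D : ℕ} (hD : ∀ᶠ N in p, 0 < L (S.part N D))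
    (hz : ∀ d, D < d → ∀ᶠ N in p, L (S.part N d) = 0) :
    (∀ᶠ n in p, 0 < L (S.Hr n)) ∧ ∀ᶠ n in shiftFilter p r, 0 < L (S.Hr n) := by
  constructor
  · rw [hp]
    filter_upwards [hD, hinf.eventually_gt_atTop 0, (hp _).1 S.eventually_mem_hull] with t h1 h2 h3
    exact S.eventually_Hr_pos hinf h2 h1 hz h3
  · rw [eventually_shiftFilter]
    filter_upwards [hD, hinf.eventually_gt_atTop 0, S.eventually_tendsto_part,
      eventually_shiftFilter.1 (S.eventually_shiftFilter_mem_hull hp hinf)] with a h1 h2 h3 h4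
    filter_upwards [h4, ((L.continuous_of_finiteDimensional.tendsto _).comp
      (h3 D)).eventually_const_lt h1] with s h5 h6
    exact S.eventually_Hr_pos hinf (by omega) h6 hz h5

theorem sign_of_not_mem_rel (hp : MulIdem p) (hinf : Tendsto (fun n : ℕ => n) p atTop)
    {L : Module.Dual ℝ (Matrix ι ι ℝ)} (hL : L ∉ S.rel) :
    ((∀ᶠ n in p, 0 < L (S.Hr n)) ∧ ∀ᶠ n in shiftFilter p r, 0 < L (S.Hr n)) ∨
      ((∀ᶠ n in p, L (S.Hr n) < 0) ∧ ∀ᶠ n in shiftFilter p r, L (S.Hr n) < 0) := by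
  classical
  let P : ℕ → Prop := fun d => ¬ ∀ᶠ N in p, L (S.part N d) = 0
  obtain ⟨d, hdb, hd⟩ : ∃ d ≤ S.bound, P d := by
    by_contra! h
    refine hL (S.mem_rel.2 ?_)
    have : ∀ᶠ N in p, ∀ d ∈ Finset.range S.bound, L (S.part N d) = 0 :=
      (eventually_all_finset _).2 fun d hd => not_not.1 (h d (Finset.mem_range.1 hd).le)
    filter_upwards [this] with N hN
    rw [Hr_eq_sum, map_sum]
    exact Finset.sum_eq_zero fun d hd => by rw [map_smul, hN d hd, smul_zero]
  have hD : P (Nat.findGreatest P S.bound) := Nat.findGreatest_spec hdb hd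
  have hz : ∀ e, Nat.findGreatest P S.bound < e → ∀ᶠ N in p, L (S.part N e) = 0 := by
    intro e he
    rcases le_or_gt e S.bound with h | h
    · exact not_not.1 (Nat.findGreatest_is_greatest he h)
    · simp [S.part_eq_zero h.le]
  have hD' : ∀ᶠ N in p, L (S.part N (Nat.findGreatest P S.bound)) < 0 ∨
      0 < L (S.part N (Nat.findGreatest P S.bound)) :=
    (Ultrafilter.eventually_not.2 hD).mono fun N hN => lt_or_gt_of_ne hN
  rcases Ultrafilter.eventually_or.1 hD' with h | h
  · right
    simpa using S.eventually_Hr_pos_of_part_pos hp hinf (L := -L)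
      (by simpa using h) (by simpa using hz)
  · exact Or.inl (S.eventually_Hr_pos_of_part_pos hp hinf h hz)

/-- The value at `N` of the combination with coefficients `c` of the functions of the system, after
applying a matrix. -/
def evalDual (c : ι → ℝ) (N : ℕ) : Module.Dual ℝ (Matrix ι ι ℝ) where
  toFun X := ∑ b, c b * ∑ e, X b e * S.M N e
  map_add' X Y := by simp [add_mul, mul_add, Finset.sum_add_distrib]
  map_smul' t X := by
    simp only [Matrix.smul_apply, smul_eq_mul, RingHom.id_apply, Finset.mul_sum]
    exact Finset.sum_congr rfl fun b _ => Finset.sum_congr rfl fun e _ => by ring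

theorem eventually_eq_evalDual (c : ι → ℝ) (t : ℕ) :
    ∀ᶠ N in p, ∑ b, c b * (S.M (t * N) b : ℝ) = S.evalDual c N (S.Hr t) := by
  filter_upwards [S.M_mul t] with N hN
  simp [evalDual, hN, Hr, Matrix.mulVec, dotProduct]

theorem sign_combination (hp : MulIdem p) (hinf : Tendsto (fun n : ℕ => n) p atTop) (c : ι → ℝ) :
    (∀ᶠ n in p ⊔ shiftFilter p r, 0 < ∑ b, c b * (S.M n b : ℝ)) ∨
      (∀ᶠ n in p ⊔ shiftFilter p r, ∑ b, c b * (S.M n b : ℝ) < 0) ∨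
      ∀ᶠ n in p ⊔ shiftFilter p r, ∑ b, c b * (S.M n b : ℝ) = 0 := by
  simp only [eventually_sup]
  have hh := S.eventually_mem_hull
  have hh' := S.eventually_shiftFilter_mem_hull hp hinf
  let L : ℕ → Module.Dual ℝ S.hull := fun N => S.evalDual c N ∘ₗ S.hull.subtype
  by_cases h0 : ∀ᶠ N in p, L N = 0
  · have : ∀ t, S.Hr t ∈ S.hull → ∀ᶠ N in p, ∑ b, c b * (S.M (t * N) b : ℝ) = 0 := by
      intro t ht
      filter_upwards [h0, S.eventually_eq_evalDual c t] with N h1 h2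
      rw [h2]
      exact LinearMap.congr_fun h1 ⟨_, ht⟩
    exact Or.inr (Or.inr ⟨(hp _).2 (hh.mono this), hp.eventually_shiftFilter (hh'.mono this)⟩)
  · obtain ⟨x, L', hL', hx, hlim⟩ := exists_dual_limit L (Ultrafilter.eventually_not.2 h0)
    obtain ⟨L'', hL''⟩ := L'.exists_extend
    have hrel : L'' ∉ S.rel := fun h => hL' <| LinearMap.ext fun X => by
      rw [← hL'']
      exact S.mem_hull.1 X.2 _ h
    have hlim' : ∀ t, S.Hr t ∈ S.hull →
        Tendsto (fun N => x N * ∑ b, c b * (S.M (t * N) b : ℝ)) p (𝓝 (L'' (S.Hr t))) := by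
      intro t ht
      have h := hlim ⟨_, ht⟩
      rw [← hL''] at h
      refine h.congr' ?_
      filter_upwards [S.eventually_eq_evalDual c t] with N h2
      rw [h2]
      rfl
    have hpos : ∀ t, S.Hr t ∈ S.hull → 0 < L'' (S.Hr t) →
        ∀ᶠ N in p, 0 < ∑ b, c b * (S.M (t * N) b : ℝ) := fun t ht h => by
      filter_upwards [(hlim' t ht).eventually_const_lt h, hx] with N h1 h2
      exact (pos_iff_pos_of_mul_pos h1).1 h2
    have hneg : ∀ t, S.Hr t ∈ S.hull → L'' (S.Hr t) < 0 →
        ∀ᶠ N in p, ∑ b, c b * (S.M (t * N) b : ℝ) < 0 := fun t ht h => by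
      filter_upwards [(hlim' t ht).eventually_lt_const h, hx] with N h1 h2
      exact neg_of_mul_neg_right h1 h2.le
    rcases S.sign_of_not_mem_rel hp hinf hrel with ⟨h1, h2⟩ | ⟨h1, h2⟩
    · exact Or.inl ⟨(hp _).2 (by filter_upwards [hh, h1] with t using hpos t),
        hp.eventually_shiftFilter (by filter_upwards [hh', h2] with t using hpos t)⟩
    · exact Or.inr (Or.inl ⟨(hp _).2 (by filter_upwards [hh, h1] with t using hneg t),
        hp.eventually_shiftFilter (by filter_upwards [hh', h2] with t using hneg t)⟩)

end LimitSystem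

/-- A function that agrees, along `p` and along `shiftFilter p r`, with a real linear combination
of the functions of some `LimitSystem`. -/
def Representable (p r : Ultrafilter ℕ) (g : ℕ → ℝ) : Prop :=
  ∃ (ι : Type) (_ : Fintype ι) (_ : DecidableEq ι) (S : LimitSystem p r ι) (c : ι → ℝ),
    ∀ᶠ n in p ⊔ shiftFilter p r, g n = ∑ b, c b * (S.M n b : ℝ)

namespace Representable
variable {p r : Ultrafilter ℕ} {f g : ℕ → ℝ}

theorem congr (hf : Representable p r f) (h : ∀ᶠ n in p ⊔ shiftFilter p r, g n = f n) :
    Representable p r g := by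
  obtain ⟨ι, _, _, S, c, hS⟩ := hf
  exact ⟨ι, _, _, S, c, by filter_upwards [h, hS] with n h1 h2 using h1.trans h2⟩

theorem of_system {ι : Type} [Fintype ι] [DecidableEq ι] (S : LimitSystem p r ι) (b : ι) :
    Representable p r fun n => S.M n b :=
  ⟨ι, _, _, S, Pi.single b 1, Eventually.of_forall fun n => by simp [Pi.single_apply]⟩

theorem natCast : Representable p r fun n => n :=
  (of_system (LimitSystem.base p r) 1).congr <| Eventually.of_forall fun n => by
    simp [LimitSystem.base]

theorem const (x : ℝ) : Representable p r fun _ => x :=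
  ⟨Fin 2, _, _, LimitSystem.base p r, ![x, 0], Eventually.of_forall fun n => by
    simp [LimitSystem.base]⟩

theorem mul (hr : AddIdem r) (hf : Representable p r f) (hg : Representable p r g) :
    Representable p r fun n => f n * g n := by
  obtain ⟨ι, _, _, S, c, hS⟩ := hf
  obtain ⟨κ, _, _, T, e, hT⟩ := hg
  refine ⟨ι × κ, _, _, S.tensor hr T, fun b => c b.1 * e b.2, ?_⟩
  filter_upwards [hS, hT] with n h1 h2
  rw [h1, h2, Fintype.sum_mul_sum, Fintype.sum_prod_type]
  refine Finset.sum_congr rfl fun b _ => Finset.sum_congr rfl fun b' _ => ?_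
  simp only [LimitSystem.tensor, Int.cast_mul]
  ring

theorem add (hr : AddIdem r) (hf : Representable p r f) (hg : Representable p r g) :
    Representable p r fun n => f n + g n := by
  obtain ⟨ι, _, _, S, c, hS⟩ := hf
  obtain ⟨κ, _, _, T, e, hT⟩ := hg
  refine ⟨ι × κ, _, _, S.tensor hr T, fun b => c b.1 * Pi.single (M := fun _ => ℝ) T.i₀ 1 b.2 +
    Pi.single (M := fun _ => ℝ) S.i₀ 1 b.1 * e b.2, ?_⟩
  filter_upwards [hS, hT] with n h1 h2
  have hS1 : ∑ b, Pi.single (M := fun _ => ℝ) S.i₀ 1 b * (S.M n b : ℝ) = 1 := by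
    simp [Pi.single_apply, S.M_one]
  have hT1 : ∑ b, Pi.single (M := fun _ => ℝ) T.i₀ 1 b * (T.M n b : ℝ) = 1 := by
    simp [Pi.single_apply, T.M_one]
  calc f n + g n = (∑ b, c b * (S.M n b : ℝ)) *
        (∑ b, Pi.single (M := fun _ => ℝ) T.i₀ 1 b * (T.M n b : ℝ)) +
      (∑ b, Pi.single (M := fun _ => ℝ) S.i₀ 1 b * (S.M n b : ℝ)) *
        ∑ b, e b * (T.M n b : ℝ) := by rw [hS1, hT1, h1, h2, mul_one, one_mul]
    _ = _ := by
      rw [Fintype.sum_mul_sum, Fintype.sum_mul_sum, Fintype.sum_prod_type,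
        ← Finset.sum_add_distrib]
      refine Finset.sum_congr rfl fun b _ => ?_
      rw [← Finset.sum_add_distrib]
      refine Finset.sum_congr rfl fun b' _ => ?_
      simp only [LimitSystem.tensor, Int.cast_mul]
      ring

theorem sign (hp : MulIdem p) (hinf : Tendsto (fun n : ℕ => n) p atTop)
    (hf : Representable p r f) : (∀ᶠ n in p ⊔ shiftFilter p r, 0 < f n) ∨
      (∀ᶠ n in p ⊔ shiftFilter p r, f n < 0) ∨ ∀ᶠ n in p ⊔ shiftFilter p r, f n = 0 := by
  obtain ⟨ι, _, _, S, c, hS⟩ := hf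
  refine (S.sign_combination hp hinf c).imp (fun h => ?_) (Or.imp (fun h => ?_) fun h => ?_) <;>
    filter_upwards [hS, h] with n h1 h2 <;> rwa [h1]

theorem sum (hr : AddIdem r) {ι : Type} (s : Finset ι) {f : ι → ℕ → ℝ}
    (h : ∀ i ∈ s, Representable p r (f i)) : Representable p r fun n => ∑ i ∈ s, f i n := by
  classical
  induction s using Finset.induction_on with
  | empty => simpa using const 0
  | insert i s hi ih =>
    simp only [Finset.sum_insert hi]
    exact (h i (Finset.mem_insert_self i s)).add hr
      (ih fun j hj => h j (Finset.mem_insert_of_mem hj))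

theorem exists_int_approx (hp : MulIdem p) (hr : AddIdem r) (hf : Representable p r f) :
    ∃ (φ : ℕ → ℤ) (y : ℝ), Representable p r (fun n => φ n) ∧
      Tendsto (fun n => f n - φ n) (p ⊔ shiftFilter p r) (𝓝 y) := by
  obtain ⟨ι, _, _, S, c, hS⟩ := hf
  have h : ∀ b, ∃ (φ : ℕ → ℤ) (y : ℝ), Representable p r (fun n => φ n) ∧
      Tendsto (fun n => c b * S.M n b - φ n) (p ⊔ shiftFilter p r) (𝓝 y) := fun b => by
    obtain ⟨T, φ, ψ, hT, h1, h2⟩ := S.exists_extend hp hr (c b)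
    refine ⟨fun n => φ n b, ψ b, (of_system T (Sum.inr b)).congr ?_, (h1 b).sup (h2 b)⟩
    exact Eventually.of_forall fun n => by simp [hT]
  choose φ y hφ hy using h
  refine ⟨fun n => ∑ b, φ b n, ∑ b, y b, ?_, ?_⟩
  · simpa using sum hr Finset.univ fun b _ => hφ b
  · refine (tendsto_finsetSum _ fun b _ => hy b).congr' ?_
    filter_upwards [hS] with n hn
    simp [hn]

theorem floor (hp : MulIdem p) (hr : AddIdem r) (hinf : Tendsto (fun n : ℕ => n) p atTop)
    (hf : Representable p r f) : Representable p r fun n => (⌊f n⌋ : ℝ) := by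
  obtain ⟨φ, y, hφ, hy⟩ := hf.exists_int_approx hp hr
  have key : ∀ m : ℤ, (∀ᶠ n in p ⊔ shiftFilter p r, (m : ℝ) ≤ f n - φ n ∧ f n - φ n < m + 1) →
      Representable p r fun n => (⌊f n⌋ : ℝ) := fun m hm => by
    refine (hφ.add hr (const (m : ℝ))).congr ?_
    filter_upwards [hm] with n hn
    have : ⌊f n⌋ = φ n + m := by
      rw [Int.floor_eq_iff]
      push_cast
      constructor <;> linarith [hn.1, hn.2]
    rw [this]
    push_cast
    rfl
  have hlt : ∀ᶠ n in p ⊔ shiftFilter p r, f n - φ n < ⌊y⌋ + 1 :=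
    hy.eventually_lt_const (Int.lt_floor_add_one y)
  rcases (Int.floor_le y).eq_or_lt with h | h
  · have hge : ∀ᶠ n in p ⊔ shiftFilter p r, (⌊y⌋ : ℝ) - 1 < f n - φ n :=
      hy.eventually_const_lt (by linarith)
    have hdiff : Representable p r fun n => f n + ((-1) * φ n + (-⌊y⌋)) :=
      hf.add hr (((const (-1)).mul hr hφ).add hr (const _))
    have hcase : (∀ᶠ n in p ⊔ shiftFilter p r, 0 ≤ f n + ((-1) * φ n + (-⌊y⌋))) ∨
        ∀ᶠ n in p ⊔ shiftFilter p r, f n + ((-1) * φ n + (-⌊y⌋)) < 0 := by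
      rcases hdiff.sign hp hinf with h | h | h
      · exact Or.inl (h.mono fun n hn => hn.le)
      · exact Or.inr h
      · exact Or.inl (h.mono fun n hn => hn.ge)
    rcases hcase with h | h
    · refine key ⌊y⌋ ?_
      filter_upwards [hlt, h] with n h1 h2
      exact ⟨by linarith, h1⟩
    · refine key (⌊y⌋ - 1) ?_
      filter_upwards [hge, h] with n h1 h2
      push_cast
      exact ⟨h1.le, by linarith⟩
  · refine key ⌊y⌋ ?_
    filter_upwards [hlt, hy.eventually_const_lt h] with n h1 h2 using ⟨h2.le, h1⟩

end Representable

theorem IsGenPoly.representable {p r : Ultrafilter ℕ} (hp : MulIdem p) (hr : AddIdem r)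
    (hinf : Tendsto (fun n : ℕ => n) p atTop) {d : ℕ} {f : (Fin d → ℝ) → ℝ} (hf : IsGenPoly f) :
    Representable p r fun n => f fun _ => n := by
  induction hf with
  | coord i => exact Representable.natCast
  | const c => exact Representable.const c
  | add _ _ h1 h2 => exact h1.add hr h2
  | mul _ _ h1 h2 => exact h1.mul hr h2
  | intPart _ h => exact h.floor hp hr hinf

theorem add_mul_ne_pow {k i j m s : ℕ} (hk : 2 ≤ k) (hs : 0 < s) (hd : k * k ^ i ∣ s) :
    (k ^ i + s) * k ^ j ≠ k ^ m := by
  obtain ⟨q, rfl⟩ := hd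
  intro h
  have hdvd : 1 + k * q ∣ k ^ m := ⟨k ^ i * k ^ j, by rw [← h]; ring⟩
  have hco : Nat.Coprime (1 + k * q) (k ^ m) := Nat.Coprime.pow_right _ (by simp)
  have h1 := Nat.Coprime.eq_one_of_dvd hco hdvd
  have : 0 < k * q := Nat.mul_pos (by omega) (Nat.pos_of_mul_pos_left hs)
  omega

/-- For `k ≥ 2`, the set of powers of `k` is not a generalised
polynomial set: there is no generalised polynomial `g : ℕ → ℝ` vanishing exactly
at the powers of `k`. -/
theorem powers_not_genPolySet (k : ℕ) (hk : 2 ≤ k) :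
    ¬ ∃ g : ℕ → ℝ, IsGenPolyNat g ∧ ∀ n : ℕ, g n = 0 ↔ ∃ j : ℕ, n = k ^ j := by
  rintro ⟨g, ⟨f, hf, hgf⟩, hg⟩
  obtain ⟨p, hp, hpow, hinf⟩ := exists_mulIdem k hk
  obtain ⟨r, hr, hpos⟩ := exists_addIdem
  have hrep : Representable p r g := by
    rw [funext hgf]
    exact hf.representable hp hr hinf
  have h0 : ∀ᶠ n in p, g n = 0 := hpow.mono fun n => (hg n).2
  have h1 : ∀ᶠ n in shiftFilter p r, g n = 0 := by
    rcases hrep.sign hp hinf with h | h | h <;> rw [eventually_sup] at h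
    · obtain ⟨n, hn, hn'⟩ := (h.1.and h0).exists
      exact absurd hn' hn.ne'
    · obtain ⟨n, hn, hn'⟩ := (h.1.and h0).exists
      exact absurd hn' hn.ne
    · exact h.2
  rw [eventually_shiftFilter] at h1
  obtain ⟨a, ha, i, rfl⟩ := (h1.and hpow).exists
  have hdvd : ∀ᶠ s in r, k * k ^ i ∣ s := hr.eventually_dvd (by positivity)
  obtain ⟨s, ⟨hs, hs0⟩, hsd⟩ := ((ha.and hpos).and hdvd).exists
  obtain ⟨N, hN, j, rfl⟩ := (hs.and hpow).exists
  obtain ⟨m, hm⟩ := (hg _).1 hN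
  exact add_mul_ne_pow hk hs0 hsd hm
end
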